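/- arXiv:2201.02157 — 3 statements merged into one kernel-verified Lean document; each statement's English description precedes it below -/
import Mathlib

section
/- Let Σ̂ be a two-sided countable Markov shift, ψ a Markov potential, P ∈ ℝ, and a ≠ b ∈ ℕ symbols. Let μ be a σ-invariant Borel probability measure on Σ̂ such that μ([a]) > 0, μ([b]) > 0, μ({x : x_i = a for infinitely many i ≥ 0}) = 1, μ({x : x_i = b for infinitely many i ≥ 0}) = 1, and μ([x_0 … x_n]) = μ([x_0])·exp(ψ(γ) − n·P) for every loop γ = x_0 … x_n with x_n = x_0. Then the sums p_{ab} and p_{ba} are finite, p_{aa} < 1, p_{bb} < 1, and μ([b])/μ([a]) = p_{ab}·p_{ba}/(1 − p_{bb})² = (1 − p_{aa})/(1 − p_{bb}). -/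
open MeasureTheory Filter Topology BoundedContinuousFunction
open scoped ENNReal NNReal

noncomputable section

/-! ## Countable Markov shifts (one-sided) -/

/-- The one-sided countable Markov shift over the alphabet `ℕ` determined by the
transition matrix (relation) `A`. -/
structure MShift (A : ℕ → ℕ → Prop) : Type where
  seq : ℕ → ℕ
  adm : ∀ i : ℕ, A (seq i) (seq (i + 1))

/-- The topology generated by the cylinders: the topology induced from the product
topology on `ℕ → ℕ` (with `ℕ` discrete). -/
instance (A : ℕ → ℕ → Prop) : TopologicalSpace (MShift A) :=
  TopologicalSpace.induced MShift.seq inferInstance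

/-- The Borel σ-algebra on the shift space. -/
instance (A : ℕ → ℕ → Prop) : MeasurableSpace (MShift A) := borel (MShift A)

instance (A : ℕ → ℕ → Prop) : BorelSpace (MShift A) := ⟨rfl⟩

/-- The shift map `σ`. -/
def shiftMap (A : ℕ → ℕ → Prop) (x : MShift A) : MShift A :=
  ⟨fun i => x.seq (i + 1), fun i => x.adm (i + 1)⟩

/-- No row and no column of the transition matrix is identically zero. -/
def NoZeroRC (A : ℕ → ℕ → Prop) : Prop :=
  ∀ i : ℕ, (∃ j, A i j) ∧ (∃ j, A j i)

/-- The cylinder `[x₀ … x_{n-1}]` determined by a finite word `w`. -/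
def cylSet (A : ℕ → ℕ → Prop) (w : List ℕ) : Set (MShift A) :=
  {x | ∀ i < w.length, x.seq i = w.getD i 0}

/-- A path: an admissible word `x₀ … xₙ` with `n ≥ 1` and nonempty cylinder. -/
def IsPath (A : ℕ → ℕ → Prop) (w : List ℕ) : Prop :=
  2 ≤ w.length ∧ w.Chain' A ∧ (cylSet A w).Nonempty

/-- The length `l(γ) = n` of a path `γ = x₀ … xₙ` (represented as a list of `n+1` symbols). -/
def pathLen (w : List ℕ) : ℕ := w.length - 1

/-- The weight `φ(γ) = Σ_{k=0}^{n-1} ψ(x_k x_{k+1})` of a word under a Markov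
potential determined by `ψ : ℕ → ℕ → ℝ`. -/
def pathWt (ψ : ℕ → ℕ → ℝ) : List ℕ → ℝ
  | [] => 0
  | [_] => 0
  | a :: b :: l => ψ a b + pathWt ψ (b :: l)

/-- Topological transitivity: any two symbols are connected by a path. -/
def TopTrans (A : ℕ → ℕ → Prop) : Prop :=
  ∀ a b : ℕ, ∃ w : List ℕ, IsPath A w ∧ w.headI = a ∧ w.getLastD 0 = b

/-- The Birkhoff sum `Sₙφ`. -/
def birkhoff (A : ℕ → ℕ → Prop) (φ : MShift A → ℝ) (n : ℕ) (x : MShift A) : ℝ :=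
  ∑ i ∈ Finset.range n, φ ((shiftMap A)^[i] x)

/-- The Gurevich partition function `Zₙ(φ, a)`. -/
def Zpart (A : ℕ → ℕ → Prop) (φ : MShift A → ℝ) (n : ℕ) (a : ℕ) : ℝ≥0∞ :=
  ∑' x : {x : MShift A // (shiftMap A)^[n] x = x ∧ x.seq 0 = a},
    ENNReal.ofReal (Real.exp (birkhoff A φ n x.1))

/-- `Zₙ*(φ, a)`: the partition function restricted to first returns to `a`. -/
def ZpartStar (A : ℕ → ℕ → Prop) (φ : MShift A → ℝ) (n : ℕ) (a : ℕ) : ℝ≥0∞ :=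
  ∑' x : {x : MShift A // (shiftMap A)^[n] x = x ∧ x.seq 0 = a ∧
      ∀ k, 0 < k → k < n → x.seq k ≠ a},
    ENNReal.ofReal (Real.exp (birkhoff A φ n x.1))

/-- The Gurevich pressure `P_G(φ) = limsup (1/n) log Zₙ(φ, a)` (at the symbol `a`),
as an extended real number. -/
def PGur (A : ℕ → ℕ → Prop) (φ : MShift A → ℝ) (a : ℕ) : EReal :=
  Filter.atTop.limsup fun n : ℕ => (((n : ℝ)⁻¹ : ℝ) : EReal) * ENNReal.log (Zpart A φ n a)

/-- `p` is the (common, symbol-independent) value of the Gurevich pressure of `φ`. -/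
def IsPG (A : ℕ → ℕ → Prop) (φ : MShift A → ℝ) (p : EReal) : Prop :=
  ∀ a : ℕ, (∃ x : MShift A, x.seq 0 = a) → PGur A φ a = p

/-- `φ` is a summable potential: `Σᵢ exp (sup φ|_[i]) < ∞`. -/
def SummablePot (A : ℕ → ℕ → Prop) (φ : MShift A → ℝ) : Prop :=
  ∃ s : ℕ → ℝ, Summable (fun i => Real.exp (s i)) ∧
    ∀ (i : ℕ) (x : MShift A), x.seq 0 = i → φ x ≤ s i

/-- `V` is a bound for the `n`-th variation `Varₙ(φ)`. -/
def VarBdd (A : ℕ → ℕ → Prop) (φ : MShift A → ℝ) (n : ℕ) (V : ℝ) : Prop :=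
  ∀ x y : MShift A, (∀ i < n, x.seq i = y.seq i) → |φ x - φ y| ≤ V

/-- σ-invariance of a Borel measure on the shift space. -/
def ShiftInv (A : ℕ → ℕ → Prop) (μ : Measure (MShift A)) : Prop :=
  ∀ s : Set (MShift A), MeasurableSet s → μ (shiftMap A ⁻¹' s) = μ s

/-- The maximal ergodic average `α(φ)`. -/
def alphaSup (A : ℕ → ℕ → Prop) (φ : MShift A → ℝ) : ℝ :=
  sSup {r : ℝ | ∃ μ : Measure (MShift A), IsProbabilityMeasure μ ∧ ShiftInv A μ ∧
    Integrable φ μ ∧ r = ∫ x, φ x ∂μ}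

/-- `μ` is the Gurevich–Markov (stationary Markov equilibrium) measure associated to the
Markov potential `ψ` with pressure `p`. -/
structure IsGM (A : ℕ → ℕ → Prop) (ψ : ℕ → ℕ → ℝ) (p : ℝ) (μ : Measure (MShift A)) : Prop where
  prob : IsProbabilityMeasure μ
  inv : ShiftInv A μ
  eigen : ∃ h hT : ℕ → ℝ, (∀ a, 0 < h a) ∧ (∀ a, 0 < hT a) ∧
    (∀ j : ℕ, (∑' a : {a : ℕ // A a j}, ENNReal.ofReal (Real.exp (ψ a.1 j) * h a.1))
        = ENNReal.ofReal (Real.exp p * h j)) ∧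
    (∀ j : ℕ, (∑' b : {b : ℕ // A j b}, ENNReal.ofReal (Real.exp (ψ j b.1) * hT b.1))
        = ENNReal.ofReal (Real.exp p * hT j)) ∧
    (∑' a : ℕ, ENNReal.ofReal (h a * hT a)) = 1 ∧
    (∀ w : List ℕ, w ≠ [] → w.Chain' A → (cylSet A w).Nonempty →
      μ (cylSet A w) = ENNReal.ofReal
        (h w.headI * hT (w.getLastD 0) * Real.exp (pathWt ψ w - (pathLen w : ℝ) * p)))

/-! ## Loops and main paths (one-sided) -/

/-- A loop at `a`. -/
def IsLoopAt (A : ℕ → ℕ → Prop) (a : ℕ) (w : List ℕ) : Prop :=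
  IsPath A w ∧ w.headI = a ∧ w.getLastD 0 = a

/-- The word `w` passes through `b`, i.e. some intermediate symbol of `w` equals `b`. -/
def PassesThrough (w : List ℕ) (b : ℕ) : Prop :=
  ∃ m, 0 < m ∧ m < w.length - 1 ∧ w.getD m 0 = b

/-- No intermediate symbol of `w` lies in `J`. -/
def AvoidsIn (w : List ℕ) (J : Finset ℕ) : Prop :=
  ∀ m, 0 < m → m < w.length - 1 → w.getD m 0 ∉ J

/-- A first-return loop at `c`: a loop at `c` with no intermediate occurrence of `c`. -/
def FirstRetLoop (A : ℕ → ℕ → Prop) (c : ℕ) (w : List ℕ) : Prop :=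
  IsPath A w ∧ w.headI = c ∧ w.getLastD 0 = c ∧
    ∀ m, 0 < m → m < w.length - 1 → w.getD m 0 ≠ c

/-- A main path from `i` to `j` (relative to the pair of symbols `{a, b}`): a path from
`i` to `j` with no intermediate occurrence of `a` nor of `b`. -/
def MainPath (A : ℕ → ℕ → Prop) (a b i j : ℕ) (w : List ℕ) : Prop :=
  IsPath A w ∧ w.headI = i ∧ w.getLastD 0 = j ∧
    ∀ m, 0 < m → m < w.length - 1 → w.getD m 0 ≠ a ∧ w.getD m 0 ≠ b

/-- `p_{ij}^t`: the sum of `exp(ψ(γ) − l(γ)·p)` over all main paths from `i` to `j`. -/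
def pSum (A : ℕ → ℕ → Prop) (ψ : ℕ → ℕ → ℝ) (p : ℝ) (a b i j : ℕ) : ℝ≥0∞ :=
  ∑' w : {w : List ℕ // MainPath A a b i j w},
    ENNReal.ofReal (Real.exp (pathWt ψ w.1 - (pathLen w.1 : ℝ) * p))

/-- `r_{ij}^t`: as `pSum`, restricted to main paths all of whose symbols lie in `S'`. -/
def rSum (A : ℕ → ℕ → Prop) (ψ : ℕ → ℕ → ℝ) (p : ℝ) (a b i j : ℕ) (S' : Finset ℕ) : ℝ≥0∞ :=
  ∑' w : {w : List ℕ // MainPath A a b i j w ∧ ∀ m < w.length, w.getD m 0 ∈ S'},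
    ENNReal.ofReal (Real.exp (pathWt ψ w.1 - (pathLen w.1 : ℝ) * p))

/-- Number of intermediate occurrences of symbols of `I` in the word `w`. -/
def interCount (I : Finset ℕ) (w : List ℕ) : ℕ :=
  ((w.drop 1).take (w.length - 2)).countP (fun s => decide (s ∈ I))

/-- `p_{ij}^t(n)`: as `pSum`, restricted to main paths with exactly `n` intermediate
occurrences of symbols of `I`. -/
def pSumN (A : ℕ → ℕ → Prop) (ψ : ℕ → ℕ → ℝ) (p : ℝ) (a b i j : ℕ)
    (I : Finset ℕ) (n : ℕ) : ℝ≥0∞ :=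
  ∑' w : {w : List ℕ // MainPath A a b i j w ∧ interCount I w = n},
    ENNReal.ofReal (Real.exp (pathWt ψ w.1 - (pathLen w.1 : ℝ) * p))

/-- An `I`-free path from `i` to `j`: a path from `i` to `j` with no intermediate
symbol in `I`. -/
def IFree (A : ℕ → ℕ → Prop) (I : Finset ℕ) (i j : ℕ) (w : List ℕ) : Prop :=
  IsPath A w ∧ w.headI = i ∧ w.getLastD 0 = j ∧
    ∀ m, 0 < m → m < w.length - 1 → w.getD m 0 ∉ I

/-! ## Two-sided countable Markov shifts -/

/-- The two-sided countable Markov shift determined by `A`. -/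
structure MShift2 (A : ℕ → ℕ → Prop) : Type where
  seq : ℤ → ℕ
  adm : ∀ i : ℤ, A (seq i) (seq (i + 1))

instance (A : ℕ → ℕ → Prop) : TopologicalSpace (MShift2 A) :=
  TopologicalSpace.induced MShift2.seq inferInstance

instance (A : ℕ → ℕ → Prop) : MeasurableSpace (MShift2 A) := borel (MShift2 A)

instance (A : ℕ → ℕ → Prop) : BorelSpace (MShift2 A) := ⟨rfl⟩

/-- The (invertible) shift map on the two-sided shift. -/
def shiftMap2 (A : ℕ → ℕ → Prop) (x : MShift2 A) : MShift2 A :=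
  ⟨fun i => x.seq (i + 1), fun i => x.adm (i + 1)⟩

/-- Cylinder based at coordinate 0 in the two-sided shift. -/
def cylSet2 (A : ℕ → ℕ → Prop) (w : List ℕ) : Set (MShift2 A) :=
  {x | ∀ i < w.length, x.seq (i : ℤ) = w.getD i 0}

/-- A path in the two-sided shift: an admissible word `x₀ … xₙ`, `n ≥ 1`. -/
def IsPath2 (A : ℕ → ℕ → Prop) (w : List ℕ) : Prop :=
  2 ≤ w.length ∧ w.Chain' A

/-- σ-invariance of a Borel measure on the two-sided shift. -/
def ShiftInv2 (A : ℕ → ℕ → Prop) (μ : Measure (MShift2 A)) : Prop :=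
  ∀ s : Set (MShift2 A), MeasurableSet s → μ (shiftMap2 A ⁻¹' s) = μ s

/-- Main path from `i` to `j` relative to `{a, b}` in the two-sided shift. -/
def MainPath2 (A : ℕ → ℕ → Prop) (a b i j : ℕ) (w : List ℕ) : Prop :=
  IsPath2 A w ∧ w.headI = i ∧ w.getLastD 0 = j ∧
    ∀ m, 0 < m → m < w.length - 1 → w.getD m 0 ≠ a ∧ w.getD m 0 ≠ b

/-- `p_{ij}`: the sum of `exp(ψ(γ) − l(γ)·P)` over all main paths from `i` to `j`
in the two-sided shift. -/
def pSum2 (A : ℕ → ℕ → Prop) (ψ : ℕ → ℕ → ℝ) (P : ℝ) (a b i j : ℕ) : ℝ≥0∞ :=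
  ∑' w : {w : List ℕ // MainPath2 A a b i j w},
    ENNReal.ofReal (Real.exp (pathWt ψ w.1 - (pathLen w.1 : ℝ) * P))

/-! ## The Ruelle operator and the renewal shift -/

/-- The Ruelle (transfer) operator acting on nonnegative measurable functions. -/
def ruelleOp (A : ℕ → ℕ → Prop) (ψ : MShift A → ℝ) (f : MShift A → ℝ≥0∞)
    (x : MShift A) : ℝ≥0∞ :=
  ∑' y : {y : MShift A // shiftMap A y = x}, ENNReal.ofReal (Real.exp (ψ y.1)) * f y.1

/-- The transition matrix of the renewal shift: `A(1,1) = A(1,i) = A(i, i-1) = 1` for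
every `i > 1`, all other entries `0` (alphabet `{1, 2, …}`). -/
def renewalA : ℕ → ℕ → Prop := fun i j => (i = 1 ∧ 1 ≤ j) ∨ (2 ≤ i ∧ j = i - 1)

/-- The potential `φ(x) = -x₀` on the renewal shift. -/
def phiRen : MShift renewalA → ℝ := fun x => -(x.seq 0 : ℝ)

/-- The potential `φ(x) = x₀ - x₁` on the renewal shift. -/
def phiRen2 : MShift renewalA → ℝ := fun x => (x.seq 0 : ℝ) - (x.seq 1 : ℝ)

/-- The fixed point `1̄ = (1,1,1,…)` of the renewal shift. -/
def onebar : MShift renewalA := ⟨fun _ => 1, fun _ => Or.inl ⟨rfl, le_refl 1⟩⟩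

end

/-! ## Concatenation of paths sharing an endpoint -/

/-- The factor `exp (ψ(γ) − l(γ)·P)` attached to a word. -/
noncomputable def expWt (ψ : ℕ → ℕ → ℝ) (P : ℝ) (w : List ℕ) : ℝ≥0∞ :=
  ENNReal.ofReal (Real.exp (pathWt ψ w - (pathLen w : ℝ) * P))

theorem expWt_ne_zero (ψ : ℕ → ℕ → ℝ) (P : ℝ) (w : List ℕ) : expWt ψ P w ≠ 0 := by
  simp [expWt, Real.exp_pos]

theorem expWt_ne_top (ψ : ℕ → ℕ → ℝ) (P : ℝ) (w : List ℕ) : expWt ψ P w ≠ ⊤ :=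
  ENNReal.ofReal_ne_top

theorem exists_eq_append_cons {u v : List ℕ} (hu : u ≠ []) (hv : v ≠ [])
    (h : v.headI = u.getLastD 0) : ∃ u' c v', u = u' ++ [c] ∧ v = c :: v' := by
  obtain ⟨u', c, rfl⟩ := (List.eq_nil_or_concat u).resolve_left hu
  obtain ⟨d, v', rfl⟩ := List.exists_cons_of_ne_nil hv
  simp only [List.headI_cons, List.concat_eq_append, List.getLastD_concat] at h
  exact ⟨u', c, v', by simp, by rw [h]⟩

theorem pathWt_append_cons (ψ : ℕ → ℕ → ℝ) (c : ℕ) (v : List ℕ) :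
    ∀ u : List ℕ, pathWt ψ (u ++ c :: v) = pathWt ψ (u ++ [c]) + pathWt ψ (c :: v)
  | [] => by simp [pathWt]
  | [x] => by simp [pathWt]
  | x :: y :: u => by
    have := pathWt_append_cons ψ c v (y :: u)
    simp only [List.cons_append, pathWt] at this ⊢
    rw [this, add_assoc]

theorem expWt_append_tail (ψ : ℕ → ℕ → ℝ) (P : ℝ) {u v : List ℕ} (hu : u ≠ []) (hv : v ≠ [])
    (h : v.headI = u.getLastD 0) :
    expWt ψ P (u ++ v.tail) = expWt ψ P u * expWt ψ P v := by
  obtain ⟨u', c, v', rfl, rfl⟩ := exists_eq_append_cons hu hv h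
  rw [expWt, expWt, expWt, ← ENNReal.ofReal_mul (Real.exp_pos _).le, ← Real.exp_add]
  simp only [List.tail_cons, List.append_assoc, List.singleton_append, pathLen,
    pathWt_append_cons ψ c v' u', List.length_append, List.length_cons, List.length_nil]
  congr 2
  rw [show u'.length + (v'.length + 1) - 1 = u'.length + v'.length by omega]
  simp only [zero_add, Nat.add_sub_cancel]
  push_cast
  ring

theorem getD_append_tail {u v : List ℕ} (hu : u ≠ []) (hv : v ≠ [])
    (h : v.headI = u.getLastD 0) (m : ℕ) :
    (u ++ v.tail).getD (u.length - 1 + m) 0 = v.getD m 0 := by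
  obtain ⟨u', c, v', rfl, rfl⟩ := exists_eq_append_cons hu hv h
  simp [List.getD_eq_getElem?_getD, List.getElem?_append]

theorem IsPath2.ne_nil {A : ℕ → ℕ → Prop} {w : List ℕ} (hw : IsPath2 A w) : w ≠ [] := by
  rintro rfl
  simpa using hw.1

theorem IsPath2.append_tail {A : ℕ → ℕ → Prop} {u v : List ℕ} (hu : IsPath2 A u)
    (hv : IsPath2 A v) (h : v.headI = u.getLastD 0) : IsPath2 A (u ++ v.tail) := by
  obtain ⟨u', c, v', rfl, rfl⟩ := exists_eq_append_cons hu.ne_nil hv.ne_nil h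
  refine ⟨by simpa using hu.1.trans (by simp), ?_⟩
  have h1 : (u' ++ [c]).IsChain A := hu.2
  have h2 : (c :: v').IsChain A := hv.2
  change List.IsChain A (u' ++ [c] ++ v')
  rw [List.isChain_append] at h1
  rw [List.append_assoc, List.singleton_append, List.isChain_append]
  exact ⟨h1.1, h2, by simpa using h1.2.2⟩

theorem headI_append_of_ne_nil {u : List ℕ} (hu : u ≠ []) (v : List ℕ) :
    (u ++ v).headI = u.headI := by
  obtain ⟨d, u', rfl⟩ := List.exists_cons_of_ne_nil hu
  rfl

theorem getLastD_append_tail {u v : List ℕ} (hu : u ≠ []) (hv : v ≠ [])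
    (h : v.headI = u.getLastD 0) : (u ++ v.tail).getLastD 0 = v.getLastD 0 := by
  obtain ⟨u', c, v', rfl, rfl⟩ := exists_eq_append_cons hu hv h
  simp [List.getLastD_eq_getLast?, List.getLast?_append, List.getLast?_cons]

theorem headI_eq_getD (v : List ℕ) : v.headI = v.getD 0 0 := by
  cases v <;> simp

theorem getLastD_eq_getD (v : List ℕ) : v.getLastD 0 = v.getD (v.length - 1) 0 := by
  simp [List.getLastD_eq_getLast?, List.getLast?_eq_getElem?, List.getD_eq_getElem?_getD]

/-! ## Cylinders and first hits -/

theorem measurable_seq2 (A : ℕ → ℕ → Prop) (i : ℤ) :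
    Measurable (fun x : MShift2 A => x.seq i) :=
  ((continuous_apply (A := fun _ : ℤ => ℕ) i).comp continuous_induced_dom).measurable

theorem measurableSet_cylSet2 (A : ℕ → ℕ → Prop) (w : List ℕ) :
    MeasurableSet (cylSet2 A w) := by
  simp only [cylSet2, Set.ofPred_forall]
  exact MeasurableSet.iInter fun i => MeasurableSet.iInter fun _ =>
    measurable_seq2 A i (measurableSet_singleton _)

theorem mem_cylSet2_singleton {A : ℕ → ℕ → Prop} {c : ℕ} {x : MShift2 A} :
    x ∈ cylSet2 A [c] ↔ x.seq 0 = c := by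
  simp [cylSet2]

theorem mem_cylSet2_append_tail {A : ℕ → ℕ → Prop} {u v : List ℕ} (hu : u ≠ []) (hv : v ≠ [])
    (h : v.headI = u.getLastD 0) (x : MShift2 A) :
    x ∈ cylSet2 A (u ++ v.tail) ↔ x ∈ cylSet2 A u ∧
      ∀ m < v.length, x.seq ((u.length - 1 + m : ℕ) : ℤ) = v.getD m 0 := by
  have hul := List.length_pos_iff.2 hu
  have hvl := List.length_pos_iff.2 hv
  have hlen : (u ++ v.tail).length = u.length - 1 + v.length := by
    rw [List.length_append, List.length_tail]; omega
  simp only [cylSet2, Set.mem_ofPred_eq]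
  constructor
  · refine fun hx => ⟨fun i hi => ?_, fun m hm => ?_⟩
    · rw [hx i (by omega), List.getD_append _ _ _ _ hi]
    · rw [hx _ (by omega), getD_append_tail hu hv h]
  · rintro ⟨h1, h2⟩ i hi
    by_cases hiu : i < u.length
    · rw [h1 i hiu, List.getD_append _ _ _ _ hiu]
    · obtain ⟨m, rfl⟩ : ∃ m, i = u.length - 1 + m := ⟨i - (u.length - 1), by omega⟩
      rw [h2 m (by omega), getD_append_tail hu hv h]

/-- The points of the cylinder `[u]` whose first visit to `{s, t}` strictly after the last
coordinate of `u` is a visit to `j`. -/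
def firstHit (A : ℕ → ℕ → Prop) (s t : ℕ) (u : List ℕ) (j : ℕ) : Set (MShift2 A) :=
  {x | x ∈ cylSet2 A u ∧ ∃ n : ℕ, 0 < n ∧ x.seq ((u.length - 1 + n : ℕ) : ℤ) = j ∧
    ∀ m : ℕ, 0 < m → m < n → x.seq ((u.length - 1 + m : ℕ) : ℤ) ≠ s ∧
      x.seq ((u.length - 1 + m : ℕ) : ℤ) ≠ t}

theorem mainPath2_segment {A : ℕ → ℕ → Prop} {s t : ℕ} (x : MShift2 A) (k n : ℕ) (hn : 0 < n)
    (h : ∀ m : ℕ, 0 < m → m < n → x.seq ((k + m : ℕ) : ℤ) ≠ s ∧ x.seq ((k + m : ℕ) : ℤ) ≠ t) :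
    MainPath2 A s t (x.seq k) (x.seq ((k + n : ℕ) : ℤ))
      ((List.range (n + 1)).map fun m => x.seq ((k + m : ℕ) : ℤ)) := by
  have hget : ∀ m < n + 1, ((List.range (n + 1)).map fun m => x.seq ((k + m : ℕ) : ℤ)).getD m 0
      = x.seq ((k + m : ℕ) : ℤ) := by
    intro m hm
    simp [List.getD_eq_getElem?_getD, List.getElem?_range hm]
  refine ⟨⟨by simp; omega, ?_⟩, ?_, ?_, ?_⟩
  · change List.IsChain A _
    rw [List.isChain_iff_getElem]
    intro i hi
    simp only [List.getElem_map, List.getElem_range]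
    have := x.adm ((k + i : ℕ) : ℤ)
    rwa [show ((k + i : ℕ) : ℤ) + 1 = ((k + (i + 1) : ℕ) : ℤ) by push_cast; ring] at this
  · rw [headI_eq_getD, hget 0 (by omega)]; simp
  · rw [getLastD_eq_getD]
    simp only [List.length_map, List.length_range, Nat.add_sub_cancel]
    exact hget n (by omega)
  · intro m hm hmn
    simp only [List.length_map, List.length_range, Nat.add_sub_cancel] at hmn
    rw [hget m (by omega)]
    exact h m hm hmn

theorem firstHit_eq_iUnion {A : ℕ → ℕ → Prop} (s t : ℕ) {u : List ℕ} (hu : u ≠ []) (j : ℕ) :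
    firstHit A s t u j =
      ⋃ v : {v : List ℕ // MainPath2 A s t (u.getLastD 0) j v}, cylSet2 A (u ++ v.1.tail) := by
  have hul := List.length_pos_iff.2 hu
  ext x
  simp only [Set.mem_iUnion]
  constructor
  · rintro ⟨hx, n, hn, rfl, hm⟩
    have hv := mainPath2_segment x (u.length - 1) n hn hm
    have hlast : x.seq ((u.length - 1 : ℕ) : ℤ) = u.getLastD 0 := by
      rw [getLastD_eq_getD]; exact hx _ (by omega)
    rw [hlast] at hv
    refine ⟨⟨_, hv⟩, (mem_cylSet2_append_tail hu hv.1.ne_nil hv.2.1 x).2 ⟨hx, fun m hm => ?_⟩⟩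
    simp only [List.length_map, List.length_range] at hm
    simp [List.getD_eq_getElem?_getD, List.getElem?_range hm]
  · rintro ⟨⟨v, hv⟩, hx⟩
    obtain ⟨hxu, hxv⟩ := (mem_cylSet2_append_tail hu hv.1.ne_nil hv.2.1 x).1 hx
    have h2 := hv.1.1
    refine ⟨hxu, v.length - 1, by omega, ?_, fun m hm hmn => ?_⟩
    · rw [hxv _ (by omega), ← getLastD_eq_getD, hv.2.2.1]
    · rw [hxv _ (by omega)]
      exact hv.2.2.2 m hm hmn

theorem measurableSet_firstHit {A : ℕ → ℕ → Prop} (s t : ℕ) {u : List ℕ} (hu : u ≠ [])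
    (j : ℕ) : MeasurableSet (firstHit A s t u j) := by
  rw [firstHit_eq_iUnion s t hu j]
  exact MeasurableSet.iUnion fun v => measurableSet_cylSet2 A _

theorem MainPath2.length_le_of_mem {A : ℕ → ℕ → Prop} {s t i j : ℕ} (hj : j = s ∨ j = t)
    {v w : List ℕ} (hv : MainPath2 A s t i j v) (hw : MainPath2 A s t i j w) {k : ℕ}
    {x : MShift2 A} (hxv : ∀ m < v.length, x.seq ((k + m : ℕ) : ℤ) = v.getD m 0)
    (hxw : ∀ m < w.length, x.seq ((k + m : ℕ) : ℤ) = w.getD m 0) : w.length ≤ v.length := by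
  by_contra! hlt
  have h2 := hv.1.1
  have h3 := hw.2.2.2 (v.length - 1) (by omega) (by omega)
  rw [← hxw _ (by omega), hxv _ (by omega), ← getLastD_eq_getD, hv.2.2.1] at h3
  exact hj.elim h3.1 h3.2

theorem measure_firstHit {A : ℕ → ℕ → Prop} (μ : Measure (MShift2 A)) {s t j : ℕ}
    (hj : j = s ∨ j = t) {u : List ℕ} (hu : u ≠ []) {c : ℕ} (hc : u.getLastD 0 = c) :
    μ (firstHit A s t u j) =
      ∑' v : {v : List ℕ // MainPath2 A s t c j v}, μ (cylSet2 A (u ++ v.1.tail)) := by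
  subst hc
  rw [firstHit_eq_iUnion s t hu j]
  refine measure_iUnion ?_ fun v => measurableSet_cylSet2 A _
  rintro ⟨v, hv⟩ ⟨w, hw⟩ hne
  refine Set.disjoint_left.2 fun x hxv hxw => hne (Subtype.ext ?_)
  have hxv' := ((mem_cylSet2_append_tail hu hv.1.ne_nil hv.2.1 x).1 hxv).2
  have hxw' := ((mem_cylSet2_append_tail hu hw.1.ne_nil hw.2.1 x).1 hxw).2
  have hlen : v.length = w.length :=
    le_antisymm (hw.length_le_of_mem hj hv hxw' hxv') (hv.length_le_of_mem hj hw hxv' hxw')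
  refine List.ext_getElem hlen fun m hm hm' => ?_
  have := (hxv' m hm).symm.trans (hxw' m hm')
  rwa [List.getD_eq_getElem _ _ hm, List.getD_eq_getElem _ _ hm'] at this

theorem exists_first_hit (f : ℕ → ℕ) (s t : ℕ) (h : ∀ N, ∃ i, N ≤ i ∧ f i = s) (k : ℕ) :
    ∃ n, 0 < n ∧ (f (k + n) = s ∨ f (k + n) = t) ∧
      ∀ m, 0 < m → m < n → f (k + m) ≠ s ∧ f (k + m) ≠ t := by
  classical
  have hex : ∃ n, 0 < n ∧ (f (k + n) = s ∨ f (k + n) = t) := by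
    obtain ⟨i, hi, hs⟩ := h (k + 1)
    exact ⟨i - k, by omega, Or.inl (by rwa [show k + (i - k) = i by omega])⟩
  refine ⟨Nat.find hex, (Nat.find_spec hex).1, (Nat.find_spec hex).2, fun m hm hmn => ?_⟩
  have := Nat.find_min hex hmn
  tauto

theorem cylSet2_ae_eq_firstHit_union {A : ℕ → ℕ → Prop} {μ : Measure (MShift2 A)} {s : ℕ}
    (hs : ∀ᵐ x : MShift2 A ∂μ, ∀ N : ℕ, ∃ i : ℕ, N ≤ i ∧ x.seq (i : ℤ) = s) (t : ℕ)
    (u : List ℕ) :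
    cylSet2 A u =ᵐ[μ] (firstHit A s t u s ∪ firstHit A s t u t : Set (MShift2 A)) := by
  filter_upwards [hs] with x hx
  refine propext ⟨fun hxu => ?_, fun h => h.elim And.left And.left⟩
  obtain ⟨n, hn, hst, hm⟩ := exists_first_hit (fun i => x.seq (i : ℤ)) s t hx (u.length - 1)
  exact hst.imp (fun h => ⟨hxu, n, hn, h, hm⟩) (fun h => ⟨hxu, n, hn, h, hm⟩)

theorem disjoint_firstHit {A : ℕ → ℕ → Prop} {s t : ℕ} (hst : s ≠ t) (u : List ℕ) :
    Disjoint (firstHit A s t u s) (firstHit A s t u t) := by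
  refine Set.disjoint_left.2 ?_
  rintro x ⟨-, n, hn, hs, hm⟩ ⟨-, n', hn', ht, hm'⟩
  rcases lt_trichotomy n n' with h | rfl | h
  · exact (hm' n hn h).1 hs
  · exact hst (hs.symm.trans ht)
  · exact (hm n' hn' h).2 ht

theorem measure_cylSet2_eq_add {A : ℕ → ℕ → Prop} {μ : Measure (MShift2 A)} {s t : ℕ}
    (hst : s ≠ t)
    (hs : ∀ᵐ x : MShift2 A ∂μ, ∀ N : ℕ, ∃ i : ℕ, N ≤ i ∧ x.seq (i : ℤ) = s)
    {u : List ℕ} (hu : u ≠ []) :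
    μ (cylSet2 A u) = μ (firstHit A s t u s) + μ (firstHit A s t u t) := by
  rw [measure_congr (cylSet2_ae_eq_firstHit_union hs t u),
    measure_union (disjoint_firstHit hst u) (measurableSet_firstHit s t hu t)]

/-! ## Consequences of the loop formula -/

section LoopFormula

variable {A : ℕ → ℕ → Prop} {ψ : ℕ → ℕ → ℝ} {P : ℝ} {μ : Measure (MShift2 A)} {a : ℕ}

theorem measure_cylSet2_path
    (ha : ∀ᵐ x : MShift2 A ∂μ, ∀ N : ℕ, ∃ i : ℕ, N ≤ i ∧ x.seq (i : ℤ) = a)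
    (hloop : ∀ w : List ℕ, IsPath2 A w → w.headI = a → w.getLastD 0 = a →
      μ (cylSet2 A w) = μ (cylSet2 A [a]) * expWt ψ P w)
    {w : List ℕ} (hw : IsPath2 A w) (hwa : w.headI = a) :
    μ (cylSet2 A w) =
      μ (cylSet2 A [a]) * expWt ψ P w * pSum2 A ψ P a a (w.getLastD 0) a := by
  have h := measure_congr (cylSet2_ae_eq_firstHit_union ha a w)
  rw [Set.union_self, measure_firstHit μ (Or.inl rfl) hw.ne_nil rfl] at h
  rw [h, pSum2, ← ENNReal.tsum_mul_left]
  refine tsum_congr fun v => ?_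
  obtain ⟨v, hv⟩ := v
  rw [hloop _ (hw.append_tail hv.1 hv.2.1) ((headI_append_of_ne_nil hw.ne_nil _).trans hwa)
    ((getLastD_append_tail hw.ne_nil hv.1.ne_nil hv.2.1).trans hv.2.2.1),
    expWt_append_tail ψ P hw.ne_nil hv.1.ne_nil hv.2.1, mul_assoc]
  rfl

theorem singleton_append_tail {v : List ℕ} {c : ℕ} (hv : v ≠ []) (h : v.headI = c) :
    [c] ++ v.tail = v := by
  obtain ⟨d, v', rfl⟩ := List.exists_cons_of_ne_nil hv
  simpa using h.symm

theorem measure_firstHit_singleton (t : ℕ)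
    (hloop : ∀ w : List ℕ, IsPath2 A w → w.headI = a → w.getLastD 0 = a →
      μ (cylSet2 A w) = μ (cylSet2 A [a]) * expWt ψ P w) :
    μ (firstHit A a t [a] a) = μ (cylSet2 A [a]) * pSum2 A ψ P a t a a := by
  rw [measure_firstHit μ (Or.inl rfl) (List.cons_ne_nil _ _) (c := a) rfl, pSum2, ← ENNReal.tsum_mul_left]
  refine tsum_congr fun v => ?_
  obtain ⟨v, hv⟩ := v
  rw [singleton_append_tail hv.1.ne_nil hv.2.1, hloop v hv.1 hv.2.1 hv.2.2.1]
  rfl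

variable {b : ℕ}

theorem one_eq_pSum2_add [IsProbabilityMeasure μ] (hab : a ≠ b) (hpos : μ (cylSet2 A [a]) ≠ 0)
    (ha : ∀ᵐ x : MShift2 A ∂μ, ∀ N : ℕ, ∃ i : ℕ, N ≤ i ∧ x.seq (i : ℤ) = a)
    (hloop : ∀ w : List ℕ, IsPath2 A w → w.headI = a → w.getLastD 0 = a →
      μ (cylSet2 A w) = μ (cylSet2 A [a]) * expWt ψ P w) :
    1 = pSum2 A ψ P a b a a + pSum2 A ψ P a b a b * pSum2 A ψ P a a b a := by
  have h := measure_cylSet2_eq_add hab ha (List.cons_ne_nil a [])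
  have hb : μ (firstHit A a b [a] b) =
      μ (cylSet2 A [a]) * (pSum2 A ψ P a b a b * pSum2 A ψ P a a b a) := by
    rw [measure_firstHit μ (Or.inr rfl) (List.cons_ne_nil _ _) (c := a) rfl]
    conv_rhs => rw [pSum2, ← ENNReal.tsum_mul_right, ← ENNReal.tsum_mul_left]
    refine tsum_congr fun v => ?_
    obtain ⟨v, hv⟩ := v
    rw [singleton_append_tail hv.1.ne_nil hv.2.1, measure_cylSet2_path ha hloop hv.1 hv.2.1,
      hv.2.2.1, mul_assoc]
    rfl
  rw [measure_firstHit_singleton b hloop, hb, ← mul_add] at h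
  refine (ENNReal.mul_right_inj hpos (measure_ne_top μ _)).1 ?_
  rw [mul_one]
  exact h

theorem pSum2_eq_add [IsProbabilityMeasure μ] (hab : a ≠ b) (hpos : μ (cylSet2 A [a]) ≠ 0)
    (ha : ∀ᵐ x : MShift2 A ∂μ, ∀ N : ℕ, ∃ i : ℕ, N ≤ i ∧ x.seq (i : ℤ) = a)
    (hloop : ∀ w : List ℕ, IsPath2 A w → w.headI = a → w.getLastD 0 = a →
      μ (cylSet2 A w) = μ (cylSet2 A [a]) * expWt ψ P w)
    {w : List ℕ} (hw : IsPath2 A w) (hwa : w.headI = a) (hwb : w.getLastD 0 = b) :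
    pSum2 A ψ P a a b a =
      pSum2 A ψ P a b b a + pSum2 A ψ P a b b b * pSum2 A ψ P a a b a := by
  have h := measure_cylSet2_eq_add hab ha hw.ne_nil
  have h1 : μ (firstHit A a b w a) =
      μ (cylSet2 A [a]) * expWt ψ P w * pSum2 A ψ P a b b a := by
    rw [measure_firstHit μ (Or.inl rfl) hw.ne_nil hwb, pSum2, ← ENNReal.tsum_mul_left]
    refine tsum_congr fun v => ?_
    obtain ⟨v, hv⟩ := v
    have hvw := hv.2.1.trans hwb.symm
    rw [hloop _ (hw.append_tail hv.1 hvw) ((headI_append_of_ne_nil hw.ne_nil _).trans hwa)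
      ((getLastD_append_tail hw.ne_nil hv.1.ne_nil hvw).trans hv.2.2.1),
      expWt_append_tail ψ P hw.ne_nil hv.1.ne_nil hvw, mul_assoc]
    rfl
  have h2 : μ (firstHit A a b w b) =
      μ (cylSet2 A [a]) * expWt ψ P w * (pSum2 A ψ P a b b b * pSum2 A ψ P a a b a) := by
    rw [measure_firstHit μ (Or.inr rfl) hw.ne_nil hwb]
    conv_rhs => rw [pSum2, ← ENNReal.tsum_mul_right, ← ENNReal.tsum_mul_left]
    refine tsum_congr fun v => ?_
    obtain ⟨v, hv⟩ := v
    have hvw := hv.2.1.trans hwb.symm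
    rw [measure_cylSet2_path ha hloop (hw.append_tail hv.1 hvw)
      ((headI_append_of_ne_nil hw.ne_nil _).trans hwa),
      getLastD_append_tail hw.ne_nil hv.1.ne_nil hvw, hv.2.2.1,
      expWt_append_tail ψ P hw.ne_nil hv.1.ne_nil hvw]
    simp only [mul_assoc]
    rfl
  rw [measure_cylSet2_path ha hloop hw hwa, hwb, h1, h2, ← mul_add] at h
  exact (ENNReal.mul_right_inj (mul_ne_zero hpos (expWt_ne_zero ψ P w))
    (ENNReal.mul_ne_top (measure_ne_top μ _) (expWt_ne_top ψ P w))).1 h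

end LoopFormula

theorem mainPath2_swap (A : ℕ → ℕ → Prop) (a b : ℕ) : MainPath2 A b a = MainPath2 A a b := by
  funext i j w
  simp only [MainPath2, and_comm (a := _ ≠ b)]

theorem pSum2_swap (A : ℕ → ℕ → Prop) (ψ : ℕ → ℕ → ℝ) (P : ℝ) (a b : ℕ) :
    pSum2 A ψ P b a = pSum2 A ψ P a b := by
  funext i j
  rw [pSum2, pSum2, mainPath2_swap]

theorem firstHit_swap (A : ℕ → ℕ → Prop) (a b : ℕ) : firstHit A b a = firstHit A a b := by
  funext u j
  simp only [firstHit, and_comm (a := _ ≠ b)]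

theorem exists_mainPath2 {A : ℕ → ℕ → Prop} {μ : Measure (MShift2 A)} {a b : ℕ} (hab : a ≠ b)
    (hpos : μ (cylSet2 A [a]) ≠ 0)
    (hb : ∀ᵐ x : MShift2 A ∂μ, ∀ N : ℕ, ∃ i : ℕ, N ≤ i ∧ x.seq (i : ℤ) = b) :
    ∃ w, MainPath2 A a b a b w := by
  classical
  obtain ⟨x, hxa, hxb⟩ := nonempty_of_measure_ne_zero
    (show μ (cylSet2 A [a] ∩ {x | ∀ N : ℕ, ∃ i : ℕ, N ≤ i ∧ x.seq (i : ℤ) = b}) ≠ 0 by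
      rwa [measure_inter_conull hb])
  rw [mem_cylSet2_singleton] at hxa
  have hex : ∃ n : ℕ, x.seq (n : ℤ) = b := (hxb 0).imp fun _ h => h.2
  set n := Nat.find hex with hn
  have hnb : x.seq (n : ℤ) = b := Nat.find_spec hex
  set k := Nat.findGreatest (fun m : ℕ => x.seq (m : ℤ) = a) n with hk
  have hka : x.seq (k : ℤ) = a :=
    Nat.findGreatest_spec (P := fun m : ℕ => x.seq (m : ℤ) = a) (Nat.zero_le n) (by simpa using hxa)
  have hkn : k ≤ n := Nat.findGreatest_le n
  have hne : k ≠ n := fun h => hab (by rw [← hka, ← hnb, h])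
  have := mainPath2_segment (s := a) (t := b) x k (n - k) (by omega) fun m hm hmn =>
    ⟨Nat.findGreatest_is_greatest (P := fun m : ℕ => x.seq (m : ℤ) = a) (n := n)
      (by omega) (by omega), Nat.find_min hex (by omega)⟩
  rw [show k + (n - k) = n by omega, hka, hnb] at this
  exact ⟨_, this⟩

theorem pSum2_ne_zero {A : ℕ → ℕ → Prop} (ψ : ℕ → ℕ → ℝ) (P : ℝ) {a b i j : ℕ} {w : List ℕ}
    (hw : MainPath2 A a b i j w) : pSum2 A ψ P a b i j ≠ 0 := fun h =>
  expWt_ne_zero ψ P w (ENNReal.tsum_eq_zero.1 h ⟨w, hw⟩)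

theorem measurable_shiftMap2 (A : ℕ → ℕ → Prop) : Measurable (shiftMap2 A) := by
  refine Continuous.measurable (continuous_induced_rng.2 (continuous_pi fun i => ?_))
  exact (continuous_apply (i + 1)).comp continuous_induced_dom

/-- By invariance, the set of points at `a` has the same measure as the set of points at `a` or
`b` whose next visit to `{a, b}` is a visit to `a`. -/
theorem measure_cylSet2_eq_firstHit_add {A : ℕ → ℕ → Prop} {μ : Measure (MShift2 A)}
    [IsProbabilityMeasure μ] (hinv : ShiftInv2 A μ) {a b : ℕ} (hab : a ≠ b) :
    μ (cylSet2 A [a]) = μ (firstHit A a b [a] a) + μ (firstHit A a b [b] a) := by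
  set F : Set (MShift2 A) := {x | ∃ n : ℕ, x.seq (n : ℤ) = a ∧
    ∀ m < n, x.seq (m : ℤ) ≠ a ∧ x.seq (m : ℤ) ≠ b} with hF
  set G := shiftMap2 A ⁻¹' F with hG
  set O : Set (MShift2 A) := {x | x.seq 0 ≠ a ∧ x.seq 0 ≠ b} with hO
  have hcoord : ∀ (i : ℤ) (c : ℕ), MeasurableSet {x : MShift2 A | x.seq i = c} := fun i c =>
    measurable_seq2 A i (measurableSet_singleton c)
  have hmF : MeasurableSet F := by
    simp only [hF, Set.ofPred_exists, Set.ofPred_and, Set.ofPred_forall]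
    exact MeasurableSet.iUnion fun n => (hcoord _ _).inter <| MeasurableSet.iInter fun m =>
      MeasurableSet.iInter fun _ => (hcoord _ _).compl.inter (hcoord _ _).compl
  have hmG : MeasurableSet G := measurable_shiftMap2 A hmF
  have hmO : MeasurableSet O := (hcoord _ _).compl.inter (hcoord _ _).compl
  have hGmem : ∀ x : MShift2 A, x ∈ G ↔ ∃ n : ℕ, x.seq ((n + 1 : ℕ) : ℤ) = a ∧
      ∀ m < n, x.seq ((m + 1 : ℕ) : ℤ) ≠ a ∧ x.seq ((m + 1 : ℕ) : ℤ) ≠ b := fun x => by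
    simp [hG, hF, shiftMap2]
  have hhit : ∀ c, firstHit A a b [c] a = cylSet2 A [c] ∩ G := fun c => by
    ext x
    rw [Set.mem_inter_iff, hGmem]
    simp only [firstHit, Set.mem_ofPred_eq, List.length_singleton, Nat.sub_self, zero_add]
    refine and_congr_right fun _ => ⟨?_, ?_⟩
    · rintro ⟨n, hn, h, hm⟩
      refine ⟨n - 1, by rwa [Nat.sub_add_cancel hn], fun m hmn => hm _ (by omega) (by omega)⟩
    · rintro ⟨n, h, hm⟩
      refine ⟨n + 1, by omega, h, fun m hm0 hmn => ?_⟩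
      have := hm (m - 1) (by omega)
      rwa [Nat.sub_add_cancel hm0] at this
  have hFeq : F = cylSet2 A [a] ∪ O ∩ G := by
    ext x
    rw [Set.mem_union, mem_cylSet2_singleton, Set.mem_inter_iff, hGmem]
    constructor
    · rintro ⟨n, h, hm⟩
      rcases n with _ | n
      · exact Or.inl (by simpa using h)
      · exact Or.inr ⟨by simpa [hO] using hm 0 (by omega), n, h, fun m hmn => hm _ (by omega)⟩
    · rintro (h | ⟨h0, n, h, hm⟩)
      · exact ⟨0, by simpa using h, by simp⟩
      · refine ⟨n + 1, h, fun m hmn => ?_⟩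
        rcases m with _ | m
        · simpa [hO] using h0
        · exact hm m (by omega)
  have hGeq : G = (cylSet2 A [a] ∩ G ∪ cylSet2 A [b] ∩ G) ∪ O ∩ G := by
    ext x
    simp only [Set.mem_union, Set.mem_inter_iff, mem_cylSet2_singleton, hO, Set.mem_ofPred_eq]
    tauto
  have hμF : μ F = μ (cylSet2 A [a]) + μ (O ∩ G) := by
    conv_lhs => rw [hFeq]
    refine measure_union (Set.disjoint_left.2 fun x hx hxO => ?_) (hmO.inter hmG)
    exact hxO.1.1 (mem_cylSet2_singleton.1 hx)
  have hμG : μ G = μ (cylSet2 A [a] ∩ G) + μ (cylSet2 A [b] ∩ G) + μ (O ∩ G) := by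
    conv_lhs => rw [hGeq]
    rw [measure_union _ (hmO.inter hmG), measure_union _ ((measurableSet_cylSet2 A [b]).inter hmG)]
    · refine Set.disjoint_left.2 fun x hx hx' => hab ?_
      exact (mem_cylSet2_singleton.1 hx.1).symm.trans (mem_cylSet2_singleton.1 hx'.1)
    · refine Set.disjoint_left.2 fun x hx hx' => ?_
      exact hx.elim (fun h => hx'.1.1 (mem_cylSet2_singleton.1 h.1))
        fun h => hx'.1.2 (mem_cylSet2_singleton.1 h.1)
  rw [hhit, hhit]
  have := hinv F hmF
  rw [← hG, hμF, hμG] at this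
  exact ((ENNReal.add_left_inj (measure_ne_top μ _)).1 this).symm

theorem ne_top_and_lt_one_of_renewal {paa pab pba pbb R : ℝ≥0∞} (hab : pab ≠ 0) (hba : pba ≠ 0)
    (h1 : 1 = paa + pab * R) (h2 : R = pba + pbb * R) :
    R ≠ ⊤ ∧ pab ≠ ⊤ ∧ pba ≠ ⊤ ∧ paa < 1 := by
  have hR0 : R ≠ 0 := fun h => hba (by simp [h] at h2; exact h2.symm)
  have hle : pab * R ≤ 1 := h1 ▸ le_add_self
  have hmul : pab * R ≠ ⊤ := ne_top_of_le_ne_top ENNReal.one_ne_top hle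
  have hR : R ≠ ⊤ := fun h => hmul (by rw [h, ENNReal.mul_top hab])
  refine ⟨hR, fun h => hmul (by rw [h, ENNReal.top_mul hR0]),
    ne_top_of_le_ne_top hR (by rw [h2]; exact le_self_add), ?_⟩
  have hpaa : paa ≠ ⊤ := ne_top_of_le_ne_top ENNReal.one_ne_top (by rw [h1]; exact le_self_add)
  rw [h1]
  exact ENNReal.lt_add_right hpaa (mul_ne_zero hab hR0)

theorem ratio_eq_of_renewal {μa μb S paa pab pba pbb R : ℝ≥0∞} (ha : μa ≠ 0) (ha' : μa ≠ ⊤)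
    (hb' : μb ≠ ⊤) (hS : S ≠ ⊤) (hR : R ≠ ⊤) (hab : pab ≠ ⊤) (hba : pba ≠ ⊤) (haa : paa < 1)
    (hbb : pbb < 1) (h1 : 1 = paa + pab * R) (h2 : R = pba + pbb * R)
    (f1 : μa = μa * paa + S) (f2 : μb = S + μb * pbb) :
    μb / μa = pab * pba / (1 - pbb) ^ 2 ∧ μb / μa = (1 - paa) / (1 - pbb) := by
  have hsub : 1 - pbb ≠ 0 := (tsub_pos_of_lt hbb).ne'
  have hsub' : 1 - pbb ≠ ⊤ := ENNReal.sub_ne_top ENNReal.one_ne_top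
  have hbb' := hbb.le
  have haa' := haa.le
  have hbb_top := ne_top_of_lt hbb
  have haa_top := ne_top_of_lt haa
  have e1 := congrArg ENNReal.toReal h1
  have e2 := congrArg ENNReal.toReal h2
  have e3 := congrArg ENNReal.toReal f1
  have e4 := congrArg ENNReal.toReal f2
  rw [ENNReal.toReal_add haa_top (by finiteness), ENNReal.toReal_mul, ENNReal.toReal_one] at e1
  rw [ENNReal.toReal_add hba (by finiteness), ENNReal.toReal_mul] at e2
  rw [ENNReal.toReal_add (by finiteness) hS, ENNReal.toReal_mul] at e3
  rw [ENNReal.toReal_add hS (by finiteness), ENNReal.toReal_mul] at e4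
  have hlt : pbb.toReal < 1 := by
    simpa using (ENNReal.toReal_lt_toReal hbb_top ENNReal.one_ne_top).2 hbb
  have ha0 : μa.toReal ≠ 0 := ENNReal.toReal_ne_zero.2 ⟨ha, ha'⟩
  have hq : 1 - pbb.toReal ≠ 0 := by linarith
  constructor
  · rw [← ENNReal.toReal_eq_toReal_iff' (ENNReal.div_ne_top hb' ha)
      (ENNReal.div_ne_top (by finiteness) (pow_ne_zero 2 hsub))]
    simp only [ENNReal.toReal_div, ENNReal.toReal_mul, ENNReal.toReal_pow,
      ENNReal.toReal_sub_of_le hbb' ENNReal.one_ne_top, ENNReal.toReal_one]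
    rw [div_eq_div_iff ha0 (pow_ne_zero 2 hq)]
    linear_combination (1 - pbb.toReal) * (e4 - e3) + (1 - pbb.toReal) * μa.toReal * e1
      + pab.toReal * μa.toReal * e2
  · rw [← ENNReal.toReal_eq_toReal_iff' (ENNReal.div_ne_top hb' ha)
      (ENNReal.div_ne_top (by finiteness) hsub)]
    simp only [ENNReal.toReal_div, ENNReal.toReal_sub_of_le hbb' ENNReal.one_ne_top,
      ENNReal.toReal_sub_of_le haa' ENNReal.one_ne_top, ENNReal.toReal_one]
    rw [div_eq_div_iff ha0 hq]
    linear_combination e4 - e3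

/-- On a two-sided countable Markov shift, for a σ-invariant probability
measure satisfying the loop formula and recurrence to `a` and `b`: the sums `p_{ab}`,
`p_{ba}` are finite, `p_{aa}, p_{bb} < 1`, and
`μ([b])/μ([a]) = p_{ab}p_{ba}/(1−p_{bb})² = (1−p_{aa})/(1−p_{bb})`. -/
theorem stmt8 (A : ℕ → ℕ → Prop) (hA : NoZeroRC A) (ψ : ℕ → ℕ → ℝ) (P : ℝ)
    (a b : ℕ) (hab : a ≠ b) (μ : Measure (MShift2 A)) (hprob : IsProbabilityMeasure μ)
    (hinv : ShiftInv2 A μ)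
    (hapos : 0 < μ (cylSet2 A [a])) (hbpos : 0 < μ (cylSet2 A [b]))
    (harec : μ {x : MShift2 A | ∀ N : ℕ, ∃ i : ℕ, N ≤ i ∧ x.seq (i : ℤ) = a} = 1)
    (hbrec : μ {x : MShift2 A | ∀ N : ℕ, ∃ i : ℕ, N ≤ i ∧ x.seq (i : ℤ) = b} = 1)
    (hloop : ∀ w : List ℕ, IsPath2 A w → w.getLastD 0 = w.headI →
      μ (cylSet2 A w) = μ (cylSet2 A [w.headI]) *
        ENNReal.ofReal (Real.exp (pathWt ψ w - (pathLen w : ℝ) * P))) :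
    pSum2 A ψ P a b a b ≠ ⊤ ∧ pSum2 A ψ P a b b a ≠ ⊤ ∧
    pSum2 A ψ P a b a a < 1 ∧ pSum2 A ψ P a b b b < 1 ∧
    μ (cylSet2 A [b]) / μ (cylSet2 A [a]) =
      pSum2 A ψ P a b a b * pSum2 A ψ P a b b a / (1 - pSum2 A ψ P a b b b) ^ 2 ∧
    μ (cylSet2 A [b]) / μ (cylSet2 A [a]) =
      (1 - pSum2 A ψ P a b a a) / (1 - pSum2 A ψ P a b b b) := by
  have toAE : ∀ c : ℕ, μ {x : MShift2 A | ∀ N : ℕ, ∃ i : ℕ, N ≤ i ∧ x.seq (i : ℤ) = c} = 1 →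
      ∀ᵐ x : MShift2 A ∂μ, ∀ N : ℕ, ∃ i : ℕ, N ≤ i ∧ x.seq (i : ℤ) = c := by
    intro c hc
    refine (mem_ae_iff_prob_eq_one ?_).2 hc
    simp only [Set.ofPred_forall, Set.ofPred_exists, Set.ofPred_and]
    exact MeasurableSet.iInter fun N => MeasurableSet.iUnion fun i =>
      (MeasurableSet.const _).inter (measurable_seq2 A i (measurableSet_singleton c))
  have ha := toAE a harec
  have hb := toAE b hbrec
  have hloop' : ∀ c : ℕ, ∀ w : List ℕ, IsPath2 A w → w.headI = c → w.getLastD 0 = c →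
      μ (cylSet2 A w) = μ (cylSet2 A [c]) * expWt ψ P w := by
    rintro c w hw rfl hlast
    exact hloop w hw hlast
  obtain ⟨v, hv⟩ := exists_mainPath2 hab hapos.ne' hb
  obtain ⟨w, hw⟩ := exists_mainPath2 hab.symm hbpos.ne' ha
  have a1 := one_eq_pSum2_add hab hapos.ne' ha (hloop' a)
  have a2 := pSum2_eq_add hab hapos.ne' ha (hloop' a) hv.1 hv.2.1 hv.2.2.1
  have b1 := one_eq_pSum2_add hab.symm hbpos.ne' hb (hloop' b)
  have b2 := pSum2_eq_add hab.symm hbpos.ne' hb (hloop' b) hw.1 hw.2.1 hw.2.2.1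
  have f1 := measure_cylSet2_eq_firstHit_add hinv hab
  rw [measure_firstHit_singleton b (hloop' a)] at f1
  have f2 := measure_cylSet2_eq_add hab ha (List.cons_ne_nil b [])
  rw [← firstHit_swap, measure_firstHit_singleton a (hloop' b), firstHit_swap] at f2
  have fne := measure_ne_top μ (firstHit A a b [b] a)
  rw [mainPath2_swap] at hw
  rw [pSum2_swap A ψ P a b] at b1 b2 f2
  have hab0 := pSum2_ne_zero ψ P hv
  have hba0 := pSum2_ne_zero ψ P hw
  obtain ⟨hR, hpab, hpba, hpaa⟩ := ne_top_and_lt_one_of_renewal hab0 hba0 a1 a2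
  obtain ⟨-, -, -, hpbb⟩ := ne_top_and_lt_one_of_renewal hba0 hab0 b1 b2
  exact ⟨hpab, hpba, hpaa, hpbb, ratio_eq_of_renewal hapos.ne' (measure_ne_top μ _)
    (measure_ne_top μ _) fne hR hpab hpba hpaa hpbb a1 a2 f1 f2⟩
end

section
/- Let Σ be a topologically transitive countable Markov shift and φ : Σ → ℝ a summable Markov potential with Var_1(φ) < ∞, P_G(φ) < ∞ and α(φ) = 0. Fix t ≥ 1 with P_G(tφ) ≥ 0 and assume the potential tφ admits a Gurevich–Markov measure; in particular, for every symbol c, the sum of exp(tφ(γ) − l(γ)·P_G(tφ)) over all first-return loops at c equals 1. Let I ⊂ ℕ be finite with a, b ∈ I (a ≠ b), and let N ∈ ℕ, C ≥ 0 be such that: for all i, j ∈ I there is a loop at i passing through j with length ≤ N and φ-weight ≥ −C, and for every i ∈ I and every J ⊆ I, if some loop at i has no intermediate symbol in J then there is such a loop with length ≤ N and φ-weight ≥ −C. For n ≥ 0 let p_{aa}^t(n) denote the sum of exp(tφ(γ) − l(γ)·P_G(tφ)) over all main paths γ from a to a having exactly n intermediate occurrences of symbols of I. Then for every r ≥ 0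 and every n with r·|I| ≤ n < (r+1)·|I|: p_{aa}^t(n) ≤ (1 − exp(−Ct − N·P_G(tφ)))^r. -/
open MeasureTheory Filter Topology BoundedContinuousFunction
open scoped ENNReal NNReal

noncomputable section

/-! ## First-passage sums of a substochastic matrix -/

section FirstPassage

/-- The product of the entries of a matrix `P` along a word. -/
def wordProd (P : ℕ → ℕ → ℝ≥0∞) : List ℕ → ℝ≥0∞
  | [] => 1
  | [_] => 1
  | x :: y :: l => P x y * wordProd P (y :: l)

/-- One step of a first passage to `a` that avoids `b` and counts visits to `I`: the total
weight of the continuations after a step to `y`, where `e` is the weight of stopping at `a` and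
`F m` the weight of the continuations from `y` with `m` further visits to `I`. -/
def passageStep (a b : ℕ) (I : Finset ℕ) (e : ℝ≥0∞) (F : ℕ → ℝ≥0∞) (n y : ℕ) : ℝ≥0∞ :=
  if y = a then (if n = 0 then e else 0)
  else if y = b then 0
  else if y ∈ I then (if n = 0 then 0 else F (n - 1))
  else F n

/-- The weight of the word `x :: l` if `l` ends at its first visit to `a`, avoids `b` and has
exactly `n` earlier visits to `I`; zero otherwise. -/
def passageWt (P : ℕ → ℕ → ℝ≥0∞) (a b : ℕ) (I : Finset ℕ) : ℕ → ℕ → List ℕ → ℝ≥0∞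
  | _, _, [] => 0
  | n, x, y :: l =>
      P x y * passageStep a b I (if l = [] then 1 else 0) (fun m => passageWt P a b I m y l) n y

/-- The total weight of the first passages from `x` to `a` in at most `L` steps that avoid `b`
and visit `I` exactly `n` times before. -/
def passageSum (P : ℕ → ℕ → ℝ≥0∞) (a b : ℕ) (I : Finset ℕ) : ℕ → ℕ → ℕ → ℝ≥0∞
  | 0, _, _ => 0
  | L + 1, n, x => ∑' y, P x y * passageStep a b I 1 (fun m => passageSum P a b I L m y) n y

variable {P : ℕ → ℕ → ℝ≥0∞} {a b : ℕ} {I : Finset ℕ}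

lemma tsum_list_eq (F : List ℕ → ℝ≥0∞) :
    ∑' l, F l = F [] + ∑' y, ∑' l, F (y :: l) := by
  let e : Unit ⊕ ℕ × List ℕ ≃ List ℕ :=
    { toFun := Sum.elim (fun _ => []) fun q => q.1 :: q.2
      invFun := fun l => match l with
        | [] => Sum.inl ()
        | y :: l => Sum.inr (y, l)
      left_inv := by rintro (_ | ⟨y, l⟩) <;> rfl
      right_inv := by rintro (_ | ⟨y, l⟩) <;> rfl }
  rw [← e.tsum_eq F, Summable.tsum_sum ENNReal.summable ENNReal.summable, tsum_fintype,
    ENNReal.tsum_prod']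
  simp [e]

lemma passageStep_le {e c : ℝ≥0∞} {F : ℕ → ℝ≥0∞} {n y : ℕ}
    (he : n = 0 → e ≤ c) (h₁ : y ∈ I → n ≠ 0 → F (n - 1) ≤ c) (h₂ : F n ≤ c) :
    passageStep a b I e F n y ≤ c := by
  unfold passageStep
  split_ifs <;> simp_all

lemma tsum_passageStep (e : List ℕ → ℝ≥0∞) (F : List ℕ → ℕ → ℝ≥0∞) (n y : ℕ) :
    ∑' l, passageStep a b I (e l) (F l) n y
      = passageStep a b I (∑' l, e l) (fun m => ∑' l, F l m) n y := by
  unfold passageStep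
  split_ifs <;> simp

lemma tsum_passageWt_length_le (L n x : ℕ) :
    ∑' l : List ℕ, (if l.length ≤ L then passageWt P a b I n x l else 0)
      = passageSum P a b I L n x := by
  induction L generalizing n x with
  | zero =>
    rw [passageSum, ENNReal.tsum_eq_zero]
    rintro (_ | ⟨y, l⟩) <;> simp [passageWt]
  | succ L ih =>
    rw [tsum_list_eq, passageSum]
    simp only [passageWt, ite_self, zero_add]
    refine tsum_congr fun y => ?_
    have hstep : ∀ l : List ℕ,
        (if (y :: l).length ≤ L + 1 then P x y * passageStep a b I (if l = [] then 1 else 0)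
            (fun m => passageWt P a b I m y l) n y else 0)
          = P x y * passageStep a b I (if l = [] then 1 else 0)
            (fun m => if l.length ≤ L then passageWt P a b I m y l else 0) n y := by
      intro l
      by_cases hl : l.length ≤ L
      · simp [hl]
      · have hne : l ≠ [] := by
          rintro rfl
          simp at hl
        simp [hl, hne, passageStep]
    simp only [hstep]
    rw [ENNReal.tsum_mul_left, tsum_passageStep]
    simp only [ih, tsum_ite_eq]

lemma tsum_passageWt_le {n x : ℕ} {c : ℝ≥0∞} (h : ∀ L, passageSum P a b I L n x ≤ c) :
    ∑' l, passageWt P a b I n x l ≤ c := by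
  rw [ENNReal.tsum_eq_iSup_sum]
  refine iSup_le fun s => (le_trans ?_ (h (s.sup List.length)))
  rw [← tsum_passageWt_length_le]
  refine le_trans (Finset.sum_le_sum fun l hl => ?_) (ENNReal.sum_le_tsum s)
  rw [if_pos (Finset.le_sup (f := List.length) hl)]

lemma passageWt_eq_wordProd {l : List ℕ} (hl : l ≠ []) (n x : ℕ) (hlast : l.getLastD x = a)
    (havoid : ∀ s ∈ l.dropLast, s ≠ a ∧ s ≠ b)
    (hcount : l.dropLast.countP (fun s => decide (s ∈ I)) = n) :
    passageWt P a b I n x l = wordProd P (x :: l) := by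
  induction l generalizing n x with
  | nil => exact absurd rfl hl
  | cons y l ih =>
    rw [passageWt, wordProd]
    congr 1
    rw [List.getLastD_cons] at hlast
    rcases l with _ | ⟨z, l⟩
    · simp at hlast hcount
      simp [passageStep, wordProd, hlast, ← hcount]
    · rw [List.dropLast_cons_cons] at havoid hcount
      obtain ⟨hya, hyb⟩ := havoid y (by simp)
      have ih' := fun m => ih (by simp) m y hlast
        (fun s hs => havoid s (List.mem_cons_of_mem _ hs))
      rw [List.countP_cons] at hcount
      by_cases hyI : y ∈ I
      · simp only [hyI, decide_true, if_true] at hcount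
        simp only [passageStep, hya, hyb, hyI, if_false, if_true]
        rw [if_neg (by omega), ih' _ (by omega)]
      · simp only [hyI, decide_false, Bool.false_eq_true, if_false, add_zero] at hcount
        simp only [passageStep, hya, hyb, hyI, if_false]
        exact ih' _ hcount

lemma entry_le_one (hP : ∀ x, ∑' y, P x y = 1) (x y : ℕ) : P x y ≤ 1 :=
  (hP x) ▸ ENNReal.le_tsum y

lemma wordProd_cons_le (hP : ∀ x, ∑' y, P x y = 1) (x : ℕ) (l : List ℕ) :
    wordProd P (x :: l) ≤ wordProd P l := by
  rcases l with _ | ⟨y, l⟩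
  · simp [wordProd]
  · exact mul_le_of_le_one_left' (entry_le_one hP x y)

lemma wordProd_append_le_right (hP : ∀ x, ∑' y, P x y = 1) (u v : List ℕ) :
    wordProd P (u ++ v) ≤ wordProd P v := by
  induction u with
  | nil => rfl
  | cons x u ih => exact (wordProd_cons_le hP x _).trans ih

lemma wordProd_le_one (hP : ∀ x, ∑' y, P x y = 1) (l : List ℕ) : wordProd P l ≤ 1 := by
  simpa [wordProd] using wordProd_append_le_right hP l []

lemma wordProd_append_le_left (hP : ∀ x, ∑' y, P x y = 1) (u v : List ℕ) :
    wordProd P (u ++ v) ≤ wordProd P u := by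
  induction u with
  | nil => exact wordProd_le_one hP _
  | cons x u ih =>
    rcases u with _ | ⟨y, u⟩
    · exact wordProd_le_one hP _
    · exact mul_le_mul_right ih _

/-- Removing the loops of a word does not decrease its weight. -/
lemma exists_nodup_wordProd_le (hP : ∀ x, ∑' y, P x y = 1) (x : ℕ) (l : List ℕ) :
    ∃ l' : List ℕ, (x :: l').Nodup ∧ l'.getLastD x = l.getLastD x ∧
      wordProd P (x :: l) ≤ wordProd P (x :: l') := by
  induction l generalizing x with
  | nil => exact ⟨[], by simp, rfl, le_rfl⟩
  | cons y l ih =>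
    obtain ⟨l', hnd, hlast, hle⟩ := ih y
    by_cases hx : x ∈ y :: l'
    · obtain ⟨s, u, hsu⟩ := List.append_of_mem hx
      refine ⟨u, ?_, ?_, ?_⟩
      · rw [hsu] at hnd
        exact hnd.of_append_right
      · have h := congrArg (fun w => List.getLastD w 0) hsu
        simp only [List.getLastD_cons] at h ⊢
        rw [← hlast, h, List.getLastD_eq_getLast? (l := s ++ x :: u),
          List.getLast?_append_of_ne_nil _ (by simp), ← List.getLastD_eq_getLast?,
          List.getLastD_cons]
      · refine (wordProd_cons_le hP x _).trans (hle.trans ?_)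
        rw [hsu]
        exact wordProd_append_le_right hP s _
    · refine ⟨y :: l', List.nodup_cons.2 ⟨hx, hnd⟩, ?_, ?_⟩
      · simpa only [List.getLastD_cons] using hlast
      · exact mul_le_mul_right hle _

lemma passageSum_le_one (hP : ∀ x, ∑' y, P x y = 1) (L n x : ℕ) :
    passageSum P a b I L n x ≤ 1 := by
  induction L generalizing n x with
  | zero => simp [passageSum]
  | succ L ih =>
    refine le_of_le_of_eq ?_ (hP x)
    rw [passageSum]
    refine ENNReal.tsum_le_tsum fun y => ?_
    exact mul_le_of_le_one_right' (passageStep_le (fun _ => le_rfl) (fun _ _ => ih _ _) (ih _ _))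

/-- A word through `{a, b}` carries weight that is lost by the passages with many visits to
`I`. -/
lemma passageSum_add_le (hP : ∀ x, ∑' y, P x y = 1) (ha : a ∈ I) (hb : b ∈ I)
    {n₀ : ℕ} {c : ℝ≥0∞} (hc : ∀ L n x, n₀ ≤ n → passageSum P a b I L n x ≤ c)
    (l : List ℕ) (hl : ∃ z ∈ l, z = a ∨ z = b) (L n x : ℕ)
    (hn : n₀ + l.countP (fun s => decide (s ∈ I)) ≤ n) :
    passageSum P a b I L n x + wordProd P (x :: l) * c ≤ c := by
  induction l generalizing L n x with
  | nil => simp at hl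
  | cons y l ih =>
    have hpos : 0 < (y :: l).countP (fun s => decide (s ∈ I)) := by
      rw [List.countP_pos_iff]
      obtain ⟨z, hz, rfl | rfl⟩ := hl
      exacts [⟨z, hz, by simpa⟩, ⟨z, hz, by simpa⟩]
    rcases L with _ | L
    · simpa [passageSum] using mul_le_of_le_one_left' (wordProd_le_one hP (x :: y :: l))
    have hrest : ∀ z, passageStep a b I 1 (fun m => passageSum P a b I L m z) n z ≤ c := fun z =>
      passageStep_le (by omega) (fun _ _ => hc _ _ _ (by omega)) (hc _ _ _ (by omega))
    have hy : passageStep a b I 1 (fun m => passageSum P a b I L m y) n y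
        + wordProd P (y :: l) * c ≤ c := by
      by_cases hyab : y = a ∨ y = b
      · have h0 : passageStep a b I 1 (fun m => passageSum P a b I L m y) n y = 0 := by
          unfold passageStep
          have : n ≠ 0 := by omega
          rcases hyab with h | h <;> simp [h, this]
        rw [h0, zero_add]
        exact mul_le_of_le_one_left' (wordProd_le_one hP _)
      · have hl' : ∃ z ∈ l, z = a ∨ z = b := by
          obtain ⟨z, hz, hzab⟩ := hl
          rcases List.mem_cons.1 hz with rfl | hz
          exacts [absurd hzab hyab, ⟨z, hz, hzab⟩]
        push Not at hyab
        rw [List.countP_cons] at hn hpos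
        by_cases hyI : y ∈ I
        · simp only [hyI, decide_true, if_true] at hn
          simp only [passageStep, hyab, hyI, if_false, if_true]
          rw [if_neg (by omega)]
          exact ih hl' _ _ _ (by omega)
        · simp only [hyI, decide_false, Bool.false_eq_true, if_false, add_zero] at hn
          simp only [passageStep, hyab, hyI, if_false]
          exact ih hl' _ _ _ hn
    calc passageSum P a b I (L + 1) n x + wordProd P (x :: y :: l) * c
        = ∑' z, (P x z * passageStep a b I 1 (fun m => passageSum P a b I L m z) n z
            + if z = y then P x y * wordProd P (y :: l) * c else 0) := by
          rw [ENNReal.tsum_add, tsum_ite_eq]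
          rfl
      _ ≤ ∑' z, P x z * c := by
          refine ENNReal.tsum_le_tsum fun z => ?_
          split_ifs with hz
          · subst hz
            rw [mul_assoc, ← mul_add]
            exact mul_le_mul_right hy _
          · rw [add_zero]
            exact mul_le_mul_right (hrest z) _
      _ = c := by rw [ENNReal.tsum_mul_right, hP, one_mul]

lemma countP_mem_add_one_le_card {x : ℕ} {l : List ℕ} (hx : x ∈ I) (h : (x :: l).Nodup) :
    l.countP (fun s => decide (s ∈ I)) + 1 ≤ I.card := by
  have hcount : (x :: l).countP (fun s => decide (s ∈ I))
      = l.countP (fun s => decide (s ∈ I)) + 1 := by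
    simp [hx]
  rw [← hcount, List.countP_eq_length_filter, ← List.toFinset_card_of_nodup (h.filter _)]
  refine Finset.card_le_card fun s hs => ?_
  simp only [List.mem_toFinset, List.mem_filter, decide_eq_true_eq] at hs
  exact hs.2

/-- Geometric decay of the first-passage sums in the number of visits to `I`. -/
lemma passageSum_le_pow (hP : ∀ x, ∑' y, P x y = 1) (ha : a ∈ I) (hb : b ∈ I) {ε : ℝ}
    (hε0 : 0 ≤ ε) (hε1 : ε ≤ 1)
    (hesc : ∀ i ∈ I, ∃ l : List ℕ, l.getLastD i = a ∧ ENNReal.ofReal ε ≤ wordProd P (i :: l))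
    (r : ℕ) (L n x : ℕ) (hn : r * I.card ≤ n) :
    passageSum P a b I L n x ≤ ENNReal.ofReal ((1 - ε) ^ r) := by
  induction r generalizing L n x with
  | zero => simpa using passageSum_le_one hP L n x
  | succ r ih =>
    have hcard : 0 < I.card := Finset.card_pos.2 ⟨a, ha⟩
    rw [add_one_mul] at hn
    have hI : ∀ i ∈ I, i ≠ a → ∀ L n, r * I.card + I.card ≤ n + 1 →
        passageSum P a b I L n i ≤ ENNReal.ofReal ((1 - ε) ^ (r + 1)) := by
      intro i hi hia L n hn
      obtain ⟨l, hl, hle⟩ := hesc i hi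
      obtain ⟨l', hnd, hlast, hle'⟩ := exists_nodup_wordProd_le hP i l
      rw [hl] at hlast
      have hmem : a ∈ l' := by
        rcases List.eq_nil_or_concat l' with rfl | ⟨u, z, rfl⟩
        · exact absurd hlast hia
        · simp [List.getLastD_eq_getLast?] at hlast
          simp [hlast]
      have hcount := countP_mem_add_one_le_card hi hnd
      have h := passageSum_add_le hP ha hb ih l' ⟨a, hmem, Or.inl rfl⟩ L n i (by omega)
      have h1 : (1 - ε) ^ r = (1 - ε) ^ (r + 1) + ε * (1 - ε) ^ r := by ring
      have h0 : 0 ≤ 1 - ε := by linarith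
      have h2 : ENNReal.ofReal ((1 - ε) ^ r) = ENNReal.ofReal ((1 - ε) ^ (r + 1))
          + ENNReal.ofReal ε * ENNReal.ofReal ((1 - ε) ^ r) := by
        rw [← ENNReal.ofReal_mul hε0, ← ENNReal.ofReal_add (by positivity) (by positivity), ← h1]
      have h3 : passageSum P a b I L n i + ENNReal.ofReal ε * ENNReal.ofReal ((1 - ε) ^ r)
          ≤ ENNReal.ofReal ((1 - ε) ^ (r + 1))
            + ENNReal.ofReal ε * ENNReal.ofReal ((1 - ε) ^ r) := by
        rw [← h2]
        exact le_trans (by gcongr; exact hle.trans hle') h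
      exact (ENNReal.add_le_add_iff_right
        (ENNReal.mul_ne_top ENNReal.ofReal_ne_top ENNReal.ofReal_ne_top)).1 h3
    clear ih
    induction L generalizing n x with
    | zero => simp [passageSum]
    | succ L ihL =>
      rw [passageSum]
      calc _ ≤ ∑' y, P x y * ENNReal.ofReal ((1 - ε) ^ (r + 1)) := by
            refine ENNReal.tsum_le_tsum fun y => mul_le_mul_right ?_ _
            by_cases hya : y = a
            · simp [passageStep, hya, show n ≠ 0 by omega]
            · exact passageStep_le (by omega) (fun hy _ => hI y hy hya _ _ (by omega))
                (ihL _ _ hn)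
        _ = _ := by rw [ENNReal.tsum_mul_right, hP, one_mul]

end FirstPassage

/-! ## The Markov chain of a positive eigenfunction -/

open Classical in
/-- The transition probabilities obtained by normalizing `exp (ψ - p)` on admissible pairs with
a positive function `g`. -/
def normTrans (A : ℕ → ℕ → Prop) (ψ : ℕ → ℕ → ℝ) (p : ℝ) (g : ℕ → ℝ) (x y : ℕ) : ℝ≥0∞ :=
  if A x y then ENNReal.ofReal (Real.exp (ψ x y - p) * g y / g x) else 0

lemma tsum_normTrans {A : ℕ → ℕ → Prop} {ψ : ℕ → ℕ → ℝ} {p : ℝ} {g : ℕ → ℝ}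
    (hg : ∀ x, 0 < g x)
    (heig : ∀ x, (∑' y : {y : ℕ // A x y}, ENNReal.ofReal (Real.exp (ψ x y.1) * g y.1))
      = ENNReal.ofReal (Real.exp p * g x)) (x : ℕ) :
    ∑' y, normTrans A ψ p g x y = 1 := by
  classical
  have hx := hg x
  have hpos : 0 < Real.exp p * g x := by positivity
  have h : ∀ y, normTrans A ψ p g x y = ({y | A x y} : Set ℕ).indicator
      (fun y => ENNReal.ofReal (Real.exp (ψ x y) * g y)) y
        * ENNReal.ofReal ((Real.exp p * g x)⁻¹) := by
    intro y
    have hy := hg y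
    by_cases hA : A x y
    · rw [normTrans, if_pos hA, Set.indicator_of_mem (by exact hA),
        ← ENNReal.ofReal_mul (by positivity), Real.exp_sub]
      congr 1
      field_simp
    · rw [normTrans, if_neg hA, Set.indicator_of_notMem (by exact hA), zero_mul]
  simp only [h]
  rw [ENNReal.tsum_mul_right, ← tsum_subtype]
  refine Eq.trans (congrArg (· * _) (heig x)) ?_
  rw [← ENNReal.ofReal_mul hpos.le, mul_inv_cancel₀ hpos.ne', ENNReal.ofReal_one]

lemma wordProd_normTrans {A : ℕ → ℕ → Prop} {ψ : ℕ → ℕ → ℝ} {p : ℝ} {g : ℕ → ℝ}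
    (hg : ∀ x, 0 < g x) (x : ℕ) (l : List ℕ) (hl : (x :: l).IsChain A) :
    wordProd (normTrans A ψ p g) (x :: l) = ENNReal.ofReal
      (Real.exp (pathWt ψ (x :: l) - (l.length : ℝ) * p) * g (l.getLastD x) / g x) := by
  induction l generalizing x with
  | nil => simp [wordProd, pathWt, (hg x).ne']
  | cons y l ih =>
    rw [List.isChain_cons_cons] at hl
    have hx := hg x
    have hy := hg y
    rw [wordProd, ih y hl.2, normTrans, if_pos hl.1, ← ENNReal.ofReal_mul (by positivity),
      List.getLastD_cons, pathWt]
    congr 1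
    rw [show ψ x y + pathWt ψ (y :: l) - ((y :: l).length : ℝ) * p
        = (ψ x y - p) + (pathWt ψ (y :: l) - (l.length : ℝ) * p) by
      rw [List.length_cons]; push_cast; ring, Real.exp_add]
    field_simp

lemma wordProd_normTrans_loop {A : ℕ → ℕ → Prop} {ψ : ℕ → ℕ → ℝ} {p : ℝ} {g : ℕ → ℝ}
    (hg : ∀ x, 0 < g x) (x : ℕ) (l : List ℕ) (hl : (x :: l).IsChain A)
    (hlast : l.getLastD x = x) :
    wordProd (normTrans A ψ p g) (x :: l)
      = ENNReal.ofReal (Real.exp (pathWt ψ (x :: l) - (pathLen (x :: l) : ℝ) * p)) := by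
  rw [wordProd_normTrans hg x l hl, hlast, mul_div_cancel_right₀ _ (hg x).ne']
  rfl

lemma pathWt_mul (t : ℝ) (ψ : ℕ → ℕ → ℝ) (w : List ℕ) :
    pathWt (fun u v => t * ψ u v) w = t * pathWt ψ w := by
  induction w with
  | nil => simp [pathWt]
  | cons x l ih =>
    rcases l with _ | ⟨y, l⟩
    · simp [pathWt]
    · rw [pathWt, pathWt, ih, mul_add]

lemma pSumN_le_tsum_passageWt {A : ℕ → ℕ → Prop} {ψ : ℕ → ℕ → ℝ} {p : ℝ} {g : ℕ → ℝ}
    (hg : ∀ x, 0 < g x) (a b : ℕ) (I : Finset ℕ) (n : ℕ) :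
    pSumN A ψ p a b a a I n ≤ ∑' l, passageWt (normTrans A ψ p g) a b I n a l := by
  have hcons : ∀ w : {w : List ℕ // MainPath A a b a a w ∧ interCount I w = n},
      w.1 = a :: w.1.tail := by
    rintro ⟨_ | ⟨x, l⟩, ⟨⟨h2, -⟩, hhead, -⟩, -⟩
    · simp at h2
    · simpa using hhead
  have hinj : Function.Injective
      fun w : {w : List ℕ // MainPath A a b a a w ∧ interCount I w = n} => w.1.tail := by
    intro w w' h
    refine Subtype.ext ?_
    rw [hcons w, hcons w']
    exact congrArg _ h
  refine le_trans (ENNReal.tsum_le_tsum fun w => ?_)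
    (ENNReal.tsum_comp_le_tsum_of_injective hinj _)
  obtain ⟨w, hmain⟩ := w
  have hw : w = a :: w.tail := hcons ⟨w, hmain⟩
  obtain ⟨⟨⟨h2, hch, -⟩, -, hlast, havoid⟩, hcount⟩ := hmain
  obtain ⟨l, rfl⟩ : ∃ l, w = a :: l := ⟨w.tail, hw⟩
  have hl : l ≠ [] := by
    rintro rfl
    simp at h2
  rw [List.getLastD_cons] at hlast
  refine le_of_eq ?_
  rw [← wordProd_normTrans_loop hg a l hch hlast]
  refine (passageWt_eq_wordProd hl n a hlast ?_ ?_).symm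
  · intro s hs
    obtain ⟨m, hm, rfl⟩ := List.mem_iff_getElem.1 hs
    rw [List.length_dropLast] at hm
    have h := havoid (m + 1) (by omega) (by simp; omega)
    rw [List.getD_cons_succ, List.getD_eq_getElem _ _ (by omega)] at h
    simpa [List.getElem_dropLast] using h
  · rw [← hcount, interCount, List.dropLast_eq_take]
    simp

end

/-- (Lemma on `p_{aa}^t(n)`.) For `r·|I| ≤ n < (r+1)·|I|` one has
`p_{aa}^t(n) ≤ (1 − exp(−Ct − N·P_G(tφ)))^r`. -/
theorem stmt10 (A : ℕ → ℕ → Prop) (hA : NoZeroRC A) (hTrans : TopTrans A)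
    (ψ : ℕ → ℕ → ℝ) (φ : MShift A → ℝ) (hMarkov : ∀ x, φ x = ψ (x.seq 0) (x.seq 1))
    (hsum : SummablePot A φ) (V : ℝ) (hV : VarBdd A φ 1 V)
    (hfin : ∀ a : ℕ, PGur A φ a < ⊤) (hnorm : alphaSup A φ = 0)
    (t : ℝ) (ht : 1 ≤ t) (p : ℝ) (hp : IsPG A (fun x => t * φ x) (p : EReal)) (hp0 : 0 ≤ p)
    (μ : Measure (MShift A)) (hGM : IsGM A (fun u v => t * ψ u v) p μ)
    (hret : ∀ c : ℕ, (∑' w : {w : List ℕ // FirstRetLoop A c w},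
        ENNReal.ofReal (Real.exp (pathWt (fun u v => t * ψ u v) w.1
          - (pathLen w.1 : ℝ) * p))) = 1)
    (I : Finset ℕ) (a b : ℕ) (ha : a ∈ I) (hb : b ∈ I) (hab : a ≠ b)
    (N : ℕ) (C : ℝ) (hC : 0 ≤ C)
    (hloops : ∀ i ∈ I, ∀ j ∈ I, ∃ w : List ℕ, IsLoopAt A i w ∧ PassesThrough w j ∧
        pathLen w ≤ N ∧ -C ≤ pathWt ψ w)
    (havoid : ∀ i ∈ I, ∀ J ⊆ I, (∃ w : List ℕ, IsLoopAt A i w ∧ AvoidsIn w J) →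
        ∃ w : List ℕ, IsLoopAt A i w ∧ AvoidsIn w J ∧ pathLen w ≤ N ∧ -C ≤ pathWt ψ w) :
    ∀ r n : ℕ, r * I.card ≤ n → n < (r + 1) * I.card →
      pSumN A (fun u v => t * ψ u v) p a b a a I n
        ≤ ENNReal.ofReal ((1 - Real.exp (-(C * t) - (N : ℝ) * p)) ^ r) := by
  obtain ⟨-, g, -, hg, -, heig, -, -⟩ := hGM.eigen
  intro r n hrn _
  have hP := tsum_normTrans (ψ := fun u v => t * ψ u v) hg heig
  refine (pSumN_le_tsum_passageWt hg a b I n).trans (tsum_passageWt_le fun L => ?_)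
  refine passageSum_le_pow hP ha hb (Real.exp_nonneg _) ?_ (fun i hi => ?_) r L n a hrn
  · rw [Real.exp_le_one_iff]
    have h1 : 0 ≤ C * t := mul_nonneg hC (by linarith)
    have h2 : 0 ≤ (N : ℝ) * p := by positivity
    linarith
  · obtain ⟨w, ⟨⟨-, hch, -⟩, hhead, hlast⟩, ⟨m, hm0, hm, hma⟩, hlen, hwt⟩ := hloops i hi a ha
    obtain ⟨l, rfl⟩ : ∃ l, w = i :: l := by
      rcases w with _ | ⟨x, l⟩
      · simp at hm
      · exact ⟨l, by simpa using hhead⟩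
    obtain ⟨k, rfl⟩ : ∃ k, m = k + 1 := ⟨m - 1, by omega⟩
    have hk : k < l.length := by
      simp at hm
      omega
    rw [List.getD_cons_succ, List.getD_eq_getElem _ _ hk] at hma
    rw [List.getLastD_cons] at hlast
    refine ⟨l.take (k + 1), ?_, ?_⟩
    · rw [List.take_succ_eq_append_getElem hk, hma]
      simp [List.getLastD_eq_getLast?]
    · calc ENNReal.ofReal (Real.exp (-(C * t) - (N : ℝ) * p))
          ≤ wordProd (normTrans A (fun u v => t * ψ u v) p g) (i :: l) := by
            rw [wordProd_normTrans_loop hg i l hch hlast, pathWt_mul]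
            refine ENNReal.ofReal_le_ofReal (Real.exp_le_exp.2 ?_)
            have h1 : (pathLen (i :: l) : ℝ) * p ≤ N * p :=
              mul_le_mul_of_nonneg_right (by exact_mod_cast hlen) hp0
            nlinarith
        _ ≤ _ := by
            have h := wordProd_append_le_left hP (i :: l.take (k + 1)) (l.drop (k + 1))
            rwa [List.cons_append, List.take_append_drop] at h
end

section
/- Let Σ be a topologically transitive countable Markov shift and φ : Σ → ℝ a summable Markov potential with φ ≤ 0, α(φ) = 0, Var_1(φ) < ∞ and P_G(φ) < ∞, and assume for each t ≥ 1 the potential tφ admits a Gurevich–Markov measure and P_G(tφ) ≥ 0. Let I ⊂ ℕ be finite and d > 0 with sup φ|_{[i]} < −d for every i ∉ I; let N ∈ ℕ, C ≥ 0 be constants such that for all i, j ∈ I there is a loop at i through j of length ≤ N and φ-weight ≥ −C, and such that whenever some loop at i ∈ I avoids a subset J ⊆ I in its interior there is such a loop of length ≤ N and φ-weight ≥ −C; set c = C + 2d/7 and let S' ⊂ ℕ be a finite set of symbols containing I and every i with sup φ|_{[i]} ≥ −7c. For a ≠ b ∈ I, i, j ∈ {a,b} and t ≥ 1, let p_{ij}^t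 be the sum of exp(tφ(γ) − l(γ)·P_G(tφ)) over all main paths γ from i to j, and r_{ij}^t the same sum restricted to main paths all of whose symbols lie in S'; assume p_{ij}^s < ∞ for all s ≥ 1. Then there exist T > 0 and M < ∞ such that for every pair of distinct a, b ∈ I and every t > T: p_{aa}^t ≤ r_{aa}^t + M·exp(−3Ct) and p_{ab}^t·p_{ba}^t ≤ r_{ab}^t·r_{ba}^t + M·exp(−3Ct). -/
open MeasureTheory Filter Topology BoundedContinuousFunction
open scoped ENNReal NNReal

/-! ## Sums over words -/

/-- The product of the kernel `k` along the consecutive pairs of a word. -/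
noncomputable def chainProd (k : ℕ → ℕ → ℝ≥0∞) : List ℕ → ℝ≥0∞
  | [] => 1
  | [_] => 1
  | a :: b :: l => k a b * chainProd k (b :: l)

lemma chainProd_append (k : ℕ → ℕ → ℝ≥0∞) (i : ℕ) (Z : List ℕ) :
    ∀ X : List ℕ, chainProd k (X ++ i :: Z) = chainProd k (X ++ [i]) * chainProd k (i :: Z)
  | [] => by simp [chainProd]
  | [x] => by simp [chainProd]
  | x :: y :: X => by
    have := chainProd_append k i Z (y :: X)
    simp only [List.cons_append, chainProd] at this ⊢
    rw [this, mul_assoc]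

lemma chainProd_reverse (k : ℕ → ℕ → ℝ≥0∞) :
    ∀ l : List ℕ, chainProd k l.reverse = chainProd (fun u v => k v u) l
  | [] => by simp [chainProd]
  | [x] => by simp [chainProd]
  | x :: y :: l => by
    have := chainProd_reverse k (y :: l)
    simp only [List.reverse_cons, List.append_assoc, List.cons_append, List.nil_append,
      chainProd] at this ⊢
    rw [chainProd_append, this]
    simp [chainProd, mul_comm]

lemma chainProd_cons_le (k : ℕ → ℕ → ℝ≥0∞) (x : ℕ) (c : ℝ≥0∞) (h : ∀ v, k x v ≤ c)
    (l : List ℕ) (hl : l ≠ []) : chainProd k (x :: l) ≤ c * chainProd k l := by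
  cases l with
  | nil => exact absurd rfl hl
  | cons y l =>
    rw [chainProd]
    gcongr
    exact h y

lemma chainProd_le_one (k : ℕ → ℕ → ℝ≥0∞) (h : ∀ u v, k u v ≤ 1) :
    ∀ l : List ℕ, chainProd k l ≤ 1
  | [] => le_rfl
  | [_] => le_rfl
  | x :: y :: l => by
    rw [chainProd]
    exact mul_le_one' (h x y) (chainProd_le_one k h (y :: l))

lemma chainProd_mul_le_of_superharmonic (k : ℕ → ℕ → ℝ≥0∞) (g : ℕ → ℝ≥0∞)
    (hg : ∀ u, ∑' v, k u v * g v ≤ g u) (a : ℕ) :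
    ∀ (l : List ℕ) (j : ℕ), chainProd k (j :: l ++ [a]) * g a ≤ g j
  | [], j => by
    simpa [chainProd] using (ENNReal.le_tsum (f := fun v => k j v * g v) a).trans (hg j)
  | u :: l, j => by
    have := chainProd_mul_le_of_superharmonic k g hg a l u
    simp only [List.cons_append, chainProd, mul_assoc] at this ⊢
    calc _ ≤ k j u * g u := by gcongr
      _ ≤ _ := (ENNReal.le_tsum (f := fun v => k j v * g v) u).trans (hg j)

lemma ENNReal.tsum_list {α : Type*} (f : List α → ℝ≥0∞) :
    ∑' l, f l = f [] + ∑' u, ∑' l, f (u :: l) := by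
  let e : Unit ⊕ (α × List α) ≃ List α :=
    { toFun := Sum.elim (fun _ => []) (fun p => p.1 :: p.2)
      invFun := fun l => match l with
        | [] => Sum.inl ()
        | u :: l => Sum.inr (u, l)
      left_inv := by rintro (_ | _) <;> rfl
      right_inv := by rintro (_ | _) <;> rfl }
  rw [← e.tsum_eq, ENNReal.summable.tsum_sum ENNReal.summable, ENNReal.tsum_prod']
  simp [e]

/-- If `F` is dominated by iterating the kernel `κ`, its sum over all words is dominated by any
function that is superharmonic for `κ` with source `F · []`. -/
lemma ENNReal.tsum_list_le_of_superharmonic {α : Type*} (F : α → List α → ℝ≥0∞)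
    (κ : α → α → ℝ≥0∞) (g : α → ℝ≥0∞) (hF : ∀ j u l, F j (u :: l) ≤ κ j u * F u l)
    (hg : ∀ j, F j [] + ∑' u, κ j u * g u ≤ g j) (j : α) : ∑' l, F j l ≤ g j := by
  have key : ∀ (n : ℕ) (j : α), ∑' l : List α, (if l.length < n then F j l else 0) ≤ g j := by
    intro n
    induction n with
    | zero => intro j; simp
    | succ n ih =>
      intro j
      rw [ENNReal.tsum_list]
      refine le_trans ?_ (hg j)
      gcongr with u
      · simp
      · calc ∑' l : List α, (if (u :: l).length < n + 1 then F j (u :: l) else 0)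
            ≤ ∑' l : List α, κ j u * (if l.length < n then F u l else 0) := by
              gcongr with l
              by_cases h : l.length < n <;> simp [h, hF]
          _ ≤ κ j u * g u := by
              rw [ENNReal.tsum_mul_left]
              gcongr
              exact ih u
  rw [ENNReal.tsum_eq_iSup_sum]
  refine iSup_le fun s => ?_
  refine le_trans ?_ (key (s.sup List.length + 1) j)
  refine le_trans (le_of_eq ?_) (ENNReal.sum_le_tsum s)
  refine Finset.sum_congr rfl fun l hl => ?_
  rw [if_pos (Nat.lt_succ_of_le (Finset.le_sup hl))]

/-- The total weight of the paths from `j` that first hit `a` at their end is at most `g j / g a`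
for every superharmonic `g`. -/
lemma tsum_firstHit_mul_le (k : ℕ → ℕ → ℝ≥0∞) (g : ℕ → ℝ≥0∞)
    (hg : ∀ u, ∑' v, k u v * g v ≤ g u) (a j : ℕ) :
    (∑' l : List ℕ, if a ∈ l then 0 else chainProd k (j :: l ++ [a])) * g a ≤ g j := by
  rw [← ENNReal.tsum_mul_right]
  refine ENNReal.tsum_list_le_of_superharmonic
    (fun j l => (if a ∈ l then 0 else chainProd k (j :: l ++ [a])) * g a)
    (fun j u => if u = a then 0 else k j u) g ?_ ?_ j
  · intro j u l
    by_cases hu : u = a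
    · simp [hu]
    · by_cases hl : a ∈ l
      · simp [hl]
      · simp [hl, hu, Ne.symm hu, chainProd, mul_assoc]
  · intro j
    refine le_trans (le_of_eq ?_) (hg j)
    rw [ENNReal.tsum_eq_add_tsum_ite (f := fun v => k j v * g v) a]
    simp only [List.not_mem_nil, if_false, List.cons_append, List.nil_append, chainProd, mul_one,
      ite_mul, zero_mul]
    congr 1
    exact tsum_congr fun x => by split_ifs <;> rfl

lemma tsum_list_prod_le_two (q : ℕ → ℝ≥0∞) (hq : ∑' u, q u ≤ 2⁻¹) :
    ∑' l : List ℕ, (l.map q).prod ≤ 2 := by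
  refine ENNReal.tsum_list_le_of_superharmonic (fun _ l => (l.map q).prod)
    (fun _ u => q u) (fun _ => 2) ?_ ?_ (0 : ℕ)
  · intro j u l; simp
  · intro j
    rw [ENNReal.tsum_mul_right]
    calc _ ≤ (1 : ℝ≥0∞) + 2⁻¹ * 2 := by gcongr; simp
      _ = 2 := by
        rw [ENNReal.inv_mul_cancel (by norm_num) (by norm_num)]; norm_num

lemma chainProd_le_prod (k : ℕ → ℕ → ℝ≥0∞) (I : Finset ℕ) (q : ℕ → ℝ≥0∞)
    (hkI : ∀ u ∉ I, ∀ v, k u v ≤ q u) (j : ℕ) (l : List ℕ) (hl : ∀ x ∈ l, x ∉ I) :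
    chainProd k (l ++ [j]) ≤ (l.map q).prod := by
  induction l with
  | nil => simp [chainProd]
  | cons x l ih =>
    simp only [List.mem_cons, forall_eq_or_imp] at hl
    rw [List.map_cons, List.prod_cons, List.cons_append]
    refine (chainProd_cons_le k x _ (hkI x hl.1) _ (by simp)).trans ?_
    gcongr
    exact ih hl.2

lemma chainProd_le_mul_prod (k : ℕ → ℕ → ℝ≥0∞) (I S : Finset ℕ) (q : ℕ → ℝ≥0∞) (ε : ℝ≥0∞)
    (hkI : ∀ u ∉ I, ∀ v, k u v ≤ q u) (hkS : ∀ u ∉ S, ∀ v, k u v ≤ ε * q u)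
    (j : ℕ) (l : List ℕ) (hl : ∀ x ∈ l, x ∉ I) (hS : ∃ x ∈ l, x ∉ S) :
    chainProd k (l ++ [j]) ≤ ε * (l.map q).prod := by
  induction l with
  | nil => simp at hS
  | cons x l ih =>
    simp only [List.mem_cons, forall_eq_or_imp] at hl
    rw [List.map_cons, List.prod_cons, List.cons_append]
    by_cases hx : x ∈ S
    · have hS' : ∃ y ∈ l, y ∉ S := by
        obtain ⟨y, hy, hyS⟩ := hS
        rcases List.mem_cons.1 hy with rfl | hy
        · exact absurd hx hyS
        · exact ⟨y, hy, hyS⟩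
      refine (chainProd_cons_le k x _ (hkI x hl.1) _ (by simp)).trans ?_
      rw [mul_left_comm]
      gcongr
      exact ih hl.2 hS'
    · refine (chainProd_cons_le k x _ (hkS x hx) _ (by simp)).trans ?_
      rw [mul_assoc]
      gcongr
      exact chainProd_le_prod k I q hkI j l hl.2

lemma ENNReal.tsum_le_tsum_of_injective {α β : Type*} (f : α → ℝ≥0∞) (g : β → ℝ≥0∞) (e : α → β)
    (he : Function.Injective e) (h : ∀ x, f x ≤ g (e x)) : ∑' x, f x ≤ ∑' y, g y :=
  (ENNReal.tsum_le_tsum h).trans (ENNReal.tsum_comp_le_tsum_of_injective he g)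

lemma ENNReal.tsum_option {α : Type*} (f : Option α → ℝ≥0∞) :
    ∑' o, f o = f none + ∑' x, f (some x) := by
  rw [← (Equiv.optionEquivSumPUnit.{0} α).symm.tsum_eq,
    ENNReal.summable.tsum_sum ENNReal.summable, add_comm]
  simp

lemma List.exists_split_first {α : Type*} (p : α → Prop) (l : List α) (h : ∃ x ∈ l, p x) :
    ∃ Y j Z, l = Y ++ j :: Z ∧ p j ∧ ∀ x ∈ Y, ¬ p x := by
  induction l with
  | nil => simp at h
  | cons x l ih =>
    by_cases hx : p x
    · exact ⟨[], x, l, rfl, hx, by simp⟩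
    · obtain ⟨Y, j, Z, rfl, hj, hY⟩ := ih (by simpa [hx] using h)
      exact ⟨x :: Y, j, Z, rfl, hj, by simpa [hx] using hY⟩

lemma List.exists_split_last {α : Type*} (p : α → Prop) (l : List α) (h : ∃ x ∈ l, p x) :
    ∃ X i Y, l = X ++ i :: Y ∧ p i ∧ ∀ x ∈ Y, ¬ p x := by
  obtain ⟨Y, j, Z, hl, hj, hY⟩ := List.exists_split_first p l.reverse (by simpa using h)
  refine ⟨Z.reverse, j, Y.reverse, ?_, hj, by simpa using hY⟩
  rw [← List.reverse_reverse l, hl]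
  simp

/-- A first-return word at `a` with an intermediate symbol outside `S`. -/
def LeavesLoop (a : ℕ) (S : Finset ℕ) (l : List ℕ) : Prop :=
  ∃ m : List ℕ, l = a :: m ++ [a] ∧ a ∉ m ∧ ∃ u ∈ m, u ∉ S

/-- The part of a first-return word at `a` before a given position, coded by its reversed
interior. -/
def loopHead (a : ℕ) : Option (List ℕ) → List ℕ
  | none => []
  | some X => a :: X.reverse

/-- The part of a first-return word at `a` after a given position, coded by its interior. -/
def loopTail (a : ℕ) : Option (List ℕ) → List ℕ
  | none => []
  | some Z => Z ++ [a]

lemma LeavesLoop.exists_decomp {a : ℕ} {I S : Finset ℕ} (ha : a ∈ I) {l : List ℕ}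
    (h : LeavesLoop a S l) (hIS : I ⊆ S) :
    ∃ p : (I × Option (List ℕ)) × List ℕ × (I × Option (List ℕ)),
      l = loopHead a p.1.2 ++ p.1.1.1 :: (p.2.1 ++ p.2.2.1.1 :: loopTail a p.2.2.2) ∧
      (∀ X ∈ p.1.2, a ∉ X) ∧ (∀ Z ∈ p.2.2.2, a ∉ Z) ∧
      (∀ x ∈ p.2.1, x ∉ I) ∧ ∃ x ∈ p.2.1, x ∉ S := by
  obtain ⟨m, rfl, ham, u, hu, huS⟩ := h
  obtain ⟨m₁, m₂, rfl⟩ := List.append_of_mem hu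
  have huI : u ∉ I := fun h => huS (hIS h)
  obtain ⟨X, i, Y₁, hX, hi, hY₁⟩ := List.exists_split_last (· ∈ I) (a :: m₁) ⟨a, by simp, ha⟩
  obtain ⟨Y₂, j, Z, hZ, hj, hY₂⟩ :=
    List.exists_split_first (· ∈ I) (m₂ ++ [a]) ⟨a, by simp, ha⟩
  simp only [List.mem_append, List.mem_cons, not_or] at ham
  have hox : ∃ o : Option (List ℕ), X = loopHead a o ∧ ∀ X' ∈ o, a ∉ X' := by
    cases X with
    | nil => exact ⟨none, rfl, by simp⟩
    | cons x X =>
      simp only [List.cons_append, List.cons.injEq] at hX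
      obtain ⟨rfl, rfl⟩ := hX
      refine ⟨some X.reverse, by simp [loopHead], ?_⟩
      simp only [List.mem_append, not_or] at ham
      simpa using ham.1.1
  have hoz : ∃ o : Option (List ℕ), Z = loopTail a o ∧ ∀ Z' ∈ o, a ∉ Z' := by
    rcases List.eq_nil_or_concat Z with rfl | ⟨Z', z, rfl⟩
    · exact ⟨none, rfl, by simp⟩
    · have hZ' : m₂ ++ [a] = (Y₂ ++ j :: Z') ++ [z] := by simpa using hZ
      obtain ⟨rfl, hz⟩ := List.append_inj' hZ' rfl
      simp only [List.cons.injEq, and_true] at hz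
      subst hz
      refine ⟨some Z', by simp [loopTail], ?_⟩
      simp only [List.mem_append, List.mem_cons, not_or] at ham
      simpa using ham.2.2.2.2
  obtain ⟨ox, rfl, hox⟩ := hox
  obtain ⟨oz, rfl, hoz⟩ := hoz
  refine ⟨((⟨i, hi⟩, ox), Y₁ ++ u :: Y₂, (⟨j, hj⟩, oz)), ?_, hox, hoz, ?_, u, by simp, huS⟩
  · have : a :: (m₁ ++ u :: m₂) ++ [a] = (a :: m₁) ++ u :: (m₂ ++ [a]) := by simp
    rw [this, hX, hZ]
    simp
  · intro x hx
    simp only [List.mem_append, List.mem_cons] at hx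
    rcases hx with hx | rfl | hx
    · exact hY₁ x hx
    · exact huI
    · exact hY₂ x hx

/-- The total weight of the first-return words at `a` leaving `S` is small when excursions
outside `I` are. -/
lemma ENNReal.tsum_sumElim {α β : Type*} (f : α → ℝ≥0∞) (g : β → ℝ≥0∞) :
    ∑' z, Sum.elim f g z = ∑' x, f x + ∑' y, g y :=
  ENNReal.summable.tsum_sum ENNReal.summable

lemma tsum_leavesLoop_le (k : ℕ → ℕ → ℝ≥0∞) (I S : Finset ℕ) (hIS : I ⊆ S) (q : ℕ → ℝ≥0∞)
    (ε E : ℝ≥0∞) (hk : ∀ u v, k u v ≤ 1) (hkI : ∀ u ∉ I, ∀ v, k u v ≤ q u)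
    (hkS : ∀ u ∉ S, ∀ v, k u v ≤ ε * q u) (hq : ∑' u, q u ≤ 2⁻¹) (a : ℕ) (ha : a ∈ I)
    (g g' : ℕ → ℝ≥0∞) (hg : ∀ u, ∑' v, k u v * g v ≤ g u)
    (hg' : ∀ v, ∑' u, k u v * g' u ≤ g' v) (hga : g a ≠ 0) (hga' : g' a ≠ 0)
    (hgt : g a ≠ ⊤) (hgt' : g' a ≠ ⊤)
    (hE : ∀ i ∈ I, g i ≤ E * g a) (hE' : ∀ i ∈ I, g' i ≤ E * g' a) :
    ∑' l : {l // LeavesLoop a S l}, chainProd k l.1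
      ≤ (I.card * (1 + E)) * (ε * 2 * (I.card * (1 + E))) := by
  have hit : ∀ (κ : ℕ → ℕ → ℝ≥0∞) (f : ℕ → ℝ≥0∞), (∀ u, ∑' v, κ u v * f v ≤ f u) →
      f a ≠ 0 → f a ≠ ⊤ → (∀ i ∈ I, f i ≤ E * f a) → ∀ i ∈ I,
      (∑' l : List ℕ, if a ∈ l then 0 else chainProd κ (i :: l ++ [a])) ≤ E := by
    intro κ f hf h0 ht hE i hi
    exact (ENNReal.mul_le_mul_iff_left h0 ht).1
      ((tsum_firstHit_mul_le κ f hf a i).trans (hE i hi))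
  let w : (ℕ → ℕ → ℝ≥0∞) → I × Option (List ℕ) → ℝ≥0∞ := fun κ p =>
    p.2.elim 1 fun X => if a ∈ X then 0 else chainProd κ (p.1.1 :: X ++ [a])
  have hw : ∀ (κ : ℕ → ℕ → ℝ≥0∞) (f : ℕ → ℝ≥0∞), (∀ u, ∑' v, κ u v * f v ≤ f u) →
      f a ≠ 0 → f a ≠ ⊤ → (∀ i ∈ I, f i ≤ E * f a) → ∑' p, w κ p ≤ I.card * (1 + E) := by
    intro κ f hf h0 ht hE
    rw [ENNReal.tsum_prod']
    calc _ ≤ ∑' i : I, (1 + E) := by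
          refine ENNReal.tsum_le_tsum fun i => ?_
          rw [ENNReal.tsum_option]
          have := hit κ f hf h0 ht hE i.1 i.2
          simp only [w, Option.elim]
          gcongr
      _ = _ := by rw [tsum_fintype, Finset.sum_const, Finset.card_univ, Fintype.card_coe,
            nsmul_eq_mul]
  let G : (I × Option (List ℕ)) × List ℕ × (I × Option (List ℕ)) → ℝ≥0∞ := fun p =>
    w (fun u v => k v u) p.1 * (ε * (p.2.1.map q).prod * w k p.2.2)
  choose e he using fun l : {l // LeavesLoop a S l} => l.2.exists_decomp ha hIS
  refine (ENNReal.tsum_le_tsum_of_injective _ G e ?_ ?_).trans ?_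
  · intro l l' h
    apply Subtype.ext
    rw [(he l).1, (he l').1, h]
  · intro l
    obtain ⟨h1, h2, h3, h4, h5⟩ := he l
    rw [h1]
    generalize e l = p at h2 h3 h4 h5 ⊢
    obtain ⟨⟨i, ox⟩, Y, j, oz⟩ := p
    simp only at h2 h3 h4 h5 ⊢
    rw [chainProd_append, ← List.cons_append, chainProd_append k j.1 _ (i.1 :: Y)]
    simp only [G]
    gcongr
    · cases ox with
      | none => simp [loopHead, chainProd, w]
      | some X =>
        have : loopHead a (some X) ++ [i.1] = (i.1 :: X ++ [a]).reverse := by simp [loopHead]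
        rw [this, chainProd_reverse]
        simp [w, h2 X rfl]
    · rw [List.cons_append]
      refine (chainProd_cons_le k i.1 1 (hk _) _ (by simp)).trans ?_
      rw [one_mul]
      exact chainProd_le_mul_prod k I S q ε hkI hkS j.1 Y h4 h5
    · cases oz with
      | none => simp [loopTail, chainProd, w]
      | some Z => simp [loopTail, w, h3 Z rfl]
  · have hG : ∑' p, G p = (∑' p, w (fun u v => k v u) p) *
        ((ε * ∑' Y : List ℕ, (Y.map q).prod) * ∑' p, w k p) := by
      rw [ENNReal.tsum_prod', ← ENNReal.tsum_mul_right]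
      refine tsum_congr fun p => ?_
      simp only [G]
      rw [ENNReal.tsum_mul_left, ENNReal.tsum_prod']
      congr 1
      calc _ = ∑' Y : List ℕ, ε * (Y.map q).prod * ∑' p, w k p :=
            tsum_congr fun Y => ENNReal.tsum_mul_left
        _ = _ := by rw [ENNReal.tsum_mul_right, ENNReal.tsum_mul_left]
    rw [hG]
    gcongr
    · exact hw _ g' hg' hga' hgt' hE'
    · exact tsum_list_prod_le_two q hq
    · exact hw _ g hg hga hgt hE

/-! ## The kernel of a Markov potential -/

open Classical in
/-- The kernel `exp (ψ(uv) - p)` on admissible pairs. -/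
noncomputable def potKernel (A : ℕ → ℕ → Prop) (ψ : ℕ → ℕ → ℝ) (p : ℝ) (u v : ℕ) : ℝ≥0∞ :=
  if A u v then ENNReal.ofReal (Real.exp (ψ u v - p)) else 0

lemma chainProd_potKernel (A : ℕ → ℕ → Prop) (ψ : ℕ → ℕ → ℝ) (p : ℝ) :
    ∀ w : List ℕ, w.IsChain A → chainProd (potKernel A ψ p) w =
      ENNReal.ofReal (Real.exp (pathWt ψ w - (pathLen w : ℝ) * p))
  | [], _ => by simp [chainProd, pathWt, pathLen]
  | [_], _ => by simp [chainProd, pathWt, pathLen]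
  | x :: y :: l, h => by
    rw [List.isChain_cons_cons] at h
    have := chainProd_potKernel A ψ p (y :: l) h.2
    rw [chainProd, this, potKernel, if_pos h.1, ← ENNReal.ofReal_mul (Real.exp_nonneg _),
      ← Real.exp_add]
    congr 2
    simp only [pathWt, pathLen, List.length_cons, Nat.add_sub_cancel]
    push_cast
    ring

lemma pathWt_const_mul (t : ℝ) (ψ : ℕ → ℕ → ℝ) :
    ∀ w : List ℕ, pathWt (fun u v => t * ψ u v) w = t * pathWt ψ w
  | [] => by simp [pathWt]
  | [_] => by simp [pathWt]
  | x :: y :: l => by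
    simp only [pathWt, pathWt_const_mul t ψ (y :: l)]
    ring

lemma pSum_eq_tsum_chainProd (A : ℕ → ℕ → Prop) (ψ : ℕ → ℕ → ℝ) (p : ℝ) (a b i j : ℕ) :
    pSum A ψ p a b i j =
      ∑' w : {w : List ℕ // MainPath A a b i j w}, chainProd (potKernel A ψ p) w.1 :=
  tsum_congr fun w => (chainProd_potKernel A ψ p w.1 w.2.1.2.1).symm

lemma rSum_eq_tsum_chainProd (A : ℕ → ℕ → Prop) (ψ : ℕ → ℕ → ℝ) (p : ℝ) (a b i j : ℕ)
    (S : Finset ℕ) :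
    rSum A ψ p a b i j S =
      ∑' w : {w : List ℕ // MainPath A a b i j w ∧ ∀ m < w.length, w.getD m 0 ∈ S},
        chainProd (potKernel A ψ p) w.1 :=
  tsum_congr fun w => (chainProd_potKernel A ψ p w.1 w.2.1.1.2.1).symm

lemma MainPath.exists_interior {A : ℕ → ℕ → Prop} {a b i j : ℕ} {w : List ℕ}
    (h : MainPath A a b i j w) : ∃ m, w = i :: m ++ [j] ∧ a ∉ m ∧ b ∉ m := by
  obtain ⟨⟨hlen, -, -⟩, hi, hj, hm⟩ := h
  cases w with
  | nil => simp at hlen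
  | cons x w =>
    rcases List.eq_nil_or_concat w with rfl | ⟨m, y, rfl⟩
    · simp at hlen
    · simp only [List.headI] at hi
      have hy : y = j := by
        rw [List.concat_eq_append, ← List.cons_append, List.getLastD_concat] at hj
        exact hj
      subst hi hy
      have key : ∀ u ∈ m, u ≠ a ∧ u ≠ b := by
        intro u hu
        obtain ⟨n, hn, rfl⟩ := List.getElem_of_mem hu
        have := hm (n + 1) (by omega) (by simpa using hn)
        simpa [List.getD_eq_getElem?_getD, List.getElem?_append_left hn,
          List.getElem?_eq_getElem hn] using this
      exact ⟨m, by simp, fun ha => (key a ha).1 rfl, fun hb => (key b hb).2 rfl⟩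

lemma exists_notMem_of_not_forall_getD {S : Finset ℕ} {i j : ℕ} (hi : i ∈ S) (hj : j ∈ S)
    {m : List ℕ}
    (h : ¬ ∀ n < (i :: m ++ [j]).length, (i :: m ++ [j]).getD n 0 ∈ S) : ∃ u ∈ m, u ∉ S := by
  by_contra! hm
  refine h fun n hn => ?_
  rw [List.getD_eq_getElem _ _ hn]
  have := List.getElem_mem hn
  simp only [List.cons_append, List.mem_cons, List.mem_append, List.not_mem_nil, or_false] at this
  rcases this with h | h | h
  · simpa only [List.cons_append, h] using hi
  · exact hm _ h
  · simpa only [List.cons_append, h] using hj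

lemma pSum_self_le (A : ℕ → ℕ → Prop) (ψ : ℕ → ℕ → ℝ) (p : ℝ) (a b : ℕ) (S : Finset ℕ)
    (ha : a ∈ S) :
    pSum A ψ p a b a a ≤ rSum A ψ p a b a a S +
      ∑' l : {l // LeavesLoop a S l}, chainProd (potKernel A ψ p) l.1 := by
  classical
  rw [pSum_eq_tsum_chainProd, rSum_eq_tsum_chainProd]
  have hL : ∀ w, MainPath A a b a a w → (¬ ∀ m < w.length, w.getD m 0 ∈ S) →
      LeavesLoop a S w := by
    intro w hw hS
    obtain ⟨m, rfl, ham, -⟩ := hw.exists_interior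
    exact ⟨m, rfl, ham, exists_notMem_of_not_forall_getD ha ha hS⟩
  rw [← ENNReal.tsum_sumElim
    (fun w : {w : List ℕ // MainPath A a b a a w ∧ ∀ m < w.length, w.getD m 0 ∈ S} =>
      chainProd (potKernel A ψ p) w.1)
    (fun l : {l // LeavesLoop a S l} => chainProd (potKernel A ψ p) l.1)]
  refine ENNReal.tsum_le_tsum_of_injective _ _
    (fun w => if h : ∀ m < w.1.length, w.1.getD m 0 ∈ S then Sum.inl ⟨w.1, w.2, h⟩
      else Sum.inr ⟨w.1, hL w.1 w.2 h⟩) ?_ ?_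
  · intro w w' h
    simp only at h
    split_ifs at h <;> simp at h <;> exact Subtype.ext h
  · intro w
    split_ifs <;> simp

lemma List.append_cons_inj_of_notMem_left {α : Type*} {b : α} :
    ∀ {x y z w : List α}, b ∉ x → b ∉ y → x ++ b :: z = y ++ b :: w → x = y ∧ z = w
  | [], [], _, _, _, _, h => by simpa using h
  | [], _ :: _, _, _, _, hy, h => by simp at h hy; exact absurd h.1 hy.1
  | _ :: _, [], _, _, hx, _, h => by simp at h hx; exact absurd h.1.symm hx.1
  | _ :: x, _ :: y, z, w, hx, hy, h => by
    simp only [List.cons_append, List.cons.injEq, List.mem_cons, not_or] at h hx hy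
    obtain ⟨rfl, rfl⟩ := append_cons_inj_of_notMem_left hx.2 hy.2 h.2
    exact ⟨by rw [h.1], rfl⟩

lemma pSum_mul_pSum_le (A : ℕ → ℕ → Prop) (ψ : ℕ → ℕ → ℝ) (p : ℝ) (a b : ℕ) (hab : a ≠ b)
    (S : Finset ℕ) (ha : a ∈ S) (hb : b ∈ S) :
    pSum A ψ p a b a b * pSum A ψ p a b b a ≤ rSum A ψ p a b a b S * rSum A ψ p a b b a S +
      ∑' l : {l // LeavesLoop a S l}, chainProd (potKernel A ψ p) l.1 := by
  classical
  rw [pSum_eq_tsum_chainProd, rSum_eq_tsum_chainProd, pSum_eq_tsum_chainProd,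
    rSum_eq_tsum_chainProd]
  have hmul : ∀ {α β : Type} (f : α → ℝ≥0∞) (g : β → ℝ≥0∞),
      (∑' x, f x) * ∑' y, g y = ∑' z : α × β, f z.1 * g z.2 := by
    intro α β f g
    rw [ENNReal.tsum_prod', ← ENNReal.tsum_mul_right]
    exact tsum_congr fun x => ENNReal.tsum_mul_left.symm
  rw [hmul, hmul]
  have hL : ∀ w w', MainPath A a b a b w → MainPath A a b b a w' →
      ¬ ((∀ m < w.length, w.getD m 0 ∈ S) ∧ ∀ m < w'.length, w'.getD m 0 ∈ S) →
      LeavesLoop a S (w ++ w'.tail) := by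
    intro w w' hw hw' hS
    obtain ⟨m, rfl, ham, -⟩ := hw.exists_interior
    obtain ⟨m', rfl, ham', -⟩ := hw'.exists_interior
    refine ⟨m ++ b :: m', by simp, by simp [ham, ham', hab], ?_⟩
    rcases not_and_or.1 hS with h | h
    · obtain ⟨u, hu, huS⟩ := exists_notMem_of_not_forall_getD ha hb h
      exact ⟨u, by simp [hu], huS⟩
    · obtain ⟨u, hu, huS⟩ := exists_notMem_of_not_forall_getD hb ha h
      exact ⟨u, by simp [hu], huS⟩
  let R (i j : ℕ) := {w : List ℕ // MainPath A a b i j w ∧ ∀ m < w.length, w.getD m 0 ∈ S}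
  rw [← ENNReal.tsum_sumElim
    (fun z : R a b × R b a =>
      chainProd (potKernel A ψ p) z.1.1 * chainProd (potKernel A ψ p) z.2.1)
    (fun l : {l // LeavesLoop a S l} => chainProd (potKernel A ψ p) l.1)]
  refine ENNReal.tsum_le_tsum_of_injective _ _
    (fun z => if h : (∀ m < z.1.1.length, z.1.1.getD m 0 ∈ S) ∧
        ∀ m < z.2.1.length, z.2.1.getD m 0 ∈ S
      then Sum.inl (⟨z.1.1, z.1.2, h.1⟩, ⟨z.2.1, z.2.2, h.2⟩)
      else Sum.inr ⟨z.1.1 ++ z.2.1.tail, hL z.1.1 z.2.1 z.1.2 z.2.2 h⟩) ?_ ?_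
  · rintro ⟨⟨w₁, h₁⟩, w₂, h₂⟩ ⟨⟨w₁', h₁'⟩, w₂', h₂'⟩ h
    simp only at h
    split_ifs at h
    · simpa [R] using h
    · obtain ⟨m₁, rfl, -, hm₁⟩ := h₁.exists_interior
      obtain ⟨m₂, rfl, -, -⟩ := h₂.exists_interior
      obtain ⟨m₁', rfl, -, hm₁'⟩ := h₁'.exists_interior
      obtain ⟨m₂', rfl, -, -⟩ := h₂'.exists_interior
      have hcat : m₁ ++ b :: (m₂ ++ [a]) = m₁' ++ b :: (m₂' ++ [a]) := by simpa using h
      obtain ⟨rfl, h'⟩ := List.append_cons_inj_of_notMem_left hm₁ hm₁' hcat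
      obtain rfl : m₂ = m₂' := by simpa using h'
      rfl
  · rintro ⟨⟨w₁, h₁⟩, w₂, h₂⟩
    dsimp only
    split_ifs
    · simp
    · obtain ⟨m₁, rfl, -, -⟩ := h₁.exists_interior
      obtain ⟨m₂, rfl, -, -⟩ := h₂.exists_interior
      have : a :: m₁ ++ [b] ++ (b :: m₂ ++ [a]).tail = (a :: m₁) ++ b :: (m₂ ++ [a]) := by simp
      simp only [Sum.elim_inr, this]
      rw [chainProd_append _ b (m₂ ++ [a]) (a :: m₁)]
      exact le_rfl

open Classical in
lemma tsum_potWeight_mul_le (B : ℕ → Prop) (f h : ℕ → ℝ) (p c : ℝ)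
    (H : ∑' u : {u // B u}, ENNReal.ofReal (Real.exp (f u.1) * h u.1)
      = ENNReal.ofReal (Real.exp p * c)) :
    ∑' u, (if B u then ENNReal.ofReal (Real.exp (f u - p)) else 0) * ENNReal.ofReal (h u)
      ≤ ENNReal.ofReal c := by
  have h1 : ∀ u, (if B u then ENNReal.ofReal (Real.exp (f u - p)) else 0) * ENNReal.ofReal (h u)
      = ENNReal.ofReal (Real.exp (-p)) *
        {u | B u}.indicator (fun u => ENNReal.ofReal (Real.exp (f u) * h u)) u := by
    intro u
    by_cases hu : B u
    · simp only [hu, if_true, Set.indicator, Set.mem_ofPred_eq]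
      rw [← ENNReal.ofReal_mul (Real.exp_nonneg _), ← ENNReal.ofReal_mul (Real.exp_nonneg _),
        ← mul_assoc, ← Real.exp_add, neg_add_eq_sub]
    · simp [hu, Set.indicator]
  rw [tsum_congr h1, ENNReal.tsum_mul_left, ← tsum_subtype]
  refine le_of_eq ?_
  change _ * (∑' u : {u // B u}, ENNReal.ofReal (Real.exp (f u.1) * h u.1)) = _
  rw [H, ← ENNReal.ofReal_mul (Real.exp_nonneg _), ← mul_assoc, ← Real.exp_add]
  simp

lemma NoZeroRC.exists_point {A : ℕ → ℕ → Prop} (hA : NoZeroRC A) {u v : ℕ} (h : A u v) :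
    ∃ x : MShift A, x.seq 0 = u ∧ x.seq 1 = v := by
  choose f hf using fun i => (hA i).1
  refine ⟨⟨fun n => Nat.casesOn n u fun n => f^[n] v, ?_⟩, rfl, rfl⟩
  rintro (_ | n)
  · exact h
  · simp only [Function.iterate_succ_apply']
    exact hf _

lemma PGur_mono (A : ℕ → ℕ → Prop) {φ φ' : MShift A → ℝ} (h : ∀ x, φ x ≤ φ' x) (a : ℕ) :
    PGur A φ a ≤ PGur A φ' a := by
  refine Filter.limsup_le_limsup (Filter.Eventually.of_forall fun n => ?_)
  refine mul_le_mul_of_nonneg_left (ENNReal.log_monotone ?_) ?_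
  · refine ENNReal.tsum_le_tsum fun x => ENNReal.ofReal_le_ofReal (Real.exp_le_exp.2 ?_)
    exact Finset.sum_le_sum fun i _ => h _
  · exact_mod_cast inv_nonneg.2 (Nat.cast_nonneg n)

lemma List.exists_cons_append_of_passesThrough {w : List ℕ} {y : ℕ} (h : PassesThrough w y) :
    ∃ l Z, w = w.headI :: l ++ y :: Z := by
  obtain ⟨m, hm, hmw, rfl⟩ := h
  have hlt : m < w.length := by omega
  cases w with
  | nil => simp at hlt
  | cons x w =>
    obtain ⟨n, rfl⟩ : ∃ n, m = n + 1 := ⟨m - 1, by omega⟩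
    have hn : n < w.length := by simpa using hlt
    refine ⟨w.take n, w.drop (n + 1), ?_⟩
    rw [List.getD_eq_getElem _ _ hlt]
    simp

/-- A loop at `x` through `y` yields a path from `x` to `y` of weight at least that of the
loop. -/
lemma exists_chainProd_ge_of_loop (A : ℕ → ℕ → Prop) (ψ : ℕ → ℕ → ℝ) (t p Q C : ℝ) (N : ℕ)
    (ht : 0 ≤ t) (hp : 0 ≤ p) (hpQ : p ≤ Q)
    (hk : ∀ u v, potKernel A (fun u v => t * ψ u v) p u v ≤ 1) (x y : ℕ)
    (h : ∃ w : List ℕ, IsLoopAt A x w ∧ PassesThrough w y ∧ pathLen w ≤ N ∧ -C ≤ pathWt ψ w) :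
    ∃ l, ENNReal.ofReal (Real.exp (-(C * t + N * Q))) ≤
      chainProd (potKernel A (fun u v => t * ψ u v) p) (x :: l ++ [y]) := by
  obtain ⟨w, ⟨hw, rfl, -⟩, hy, hN, hC⟩ := h
  obtain ⟨l, Z, hwl⟩ := List.exists_cons_append_of_passesThrough hy
  refine ⟨l, ?_⟩
  calc _ ≤ chainProd (potKernel A (fun u v => t * ψ u v) p) w := by
        rw [chainProd_potKernel _ _ _ _ hw.2.1, pathWt_const_mul]
        refine ENNReal.ofReal_le_ofReal (Real.exp_le_exp.2 ?_)
        have h1 : t * -C ≤ t * pathWt ψ w := by gcongr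
        have h2 : (pathLen w : ℝ) * p ≤ N * Q := by gcongr
        linarith
    _ ≤ _ := by
        rw [hwl, chainProd_append, ← hwl]
        exact mul_le_of_le_one_right' (chainProd_le_one _ hk _)

/-- (Approximation of `p_{ij}^t` by `r_{ij}^t`.) There are `T > 0` and
`M < ∞` such that for all distinct `a, b ∈ I` and all `t > T`:
`p_{aa}^t ≤ r_{aa}^t + M·exp(−3Ct)` and `p_{ab}^t p_{ba}^t ≤ r_{ab}^t r_{ba}^t + M·exp(−3Ct)`. -/
theorem stmt12 (A : ℕ → ℕ → Prop) (hA : NoZeroRC A) (hTrans : TopTrans A)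
    (ψ : ℕ → ℕ → ℝ) (φ : MShift A → ℝ) (hMarkov : ∀ x, φ x = ψ (x.seq 0) (x.seq 1))
    (hneg : ∀ x, φ x ≤ 0) (hnorm : alphaSup A φ = 0)
    (hsum : SummablePot A φ) (V : ℝ) (hV : VarBdd A φ 1 V)
    (hfin : ∀ a : ℕ, PGur A φ a < ⊤)
    (P : ℝ → ℝ) (hP : ∀ t : ℝ, 1 ≤ t → IsPG A (fun x => t * φ x) ((P t : ℝ) : EReal))
    (hP0 : ∀ t : ℝ, 1 ≤ t → 0 ≤ P t)
    (μ : ℝ → Measure (MShift A))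
    (hGM : ∀ t : ℝ, 1 ≤ t → IsGM A (fun u v => t * ψ u v) (P t) (μ t))
    (I : Finset ℕ) (d : ℝ) (hd : 0 < d)
    (hI : ∀ i ∉ I, ∀ x : MShift A, x.seq 0 = i → φ x ≤ -d)
    (N : ℕ) (C : ℝ) (hC : 0 ≤ C)
    (hloops : ∀ i ∈ I, ∀ j ∈ I, ∃ w : List ℕ, IsLoopAt A i w ∧ PassesThrough w j ∧
        pathLen w ≤ N ∧ -C ≤ pathWt ψ w)
    (havoid : ∀ i ∈ I, ∀ J ⊆ I, (∃ w : List ℕ, IsLoopAt A i w ∧ AvoidsIn w J) →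
        ∃ w : List ℕ, IsLoopAt A i w ∧ AvoidsIn w J ∧ pathLen w ≤ N ∧ -C ≤ pathWt ψ w)
    (S' : Finset ℕ) (hIS : I ⊆ S')
    (hS' : ∀ i : ℕ, (∃ x : MShift A, x.seq 0 = i ∧ -(7 * (C + 2 * d / 7)) ≤ φ x) → i ∈ S')
    (hfinp : ∀ s : ℝ, 1 ≤ s → ∀ a ∈ I, ∀ b ∈ I, a ≠ b →
      ∀ i ∈ ({a, b} : Finset ℕ), ∀ j ∈ ({a, b} : Finset ℕ),
        pSum A (fun u v => s * ψ u v) (P s) a b i j ≠ ⊤) :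
    ∃ T : ℝ, 0 < T ∧ ∃ M : ℝ, ∀ a ∈ I, ∀ b ∈ I, a ≠ b → ∀ t : ℝ, T < t →
      pSum A (fun u v => t * ψ u v) (P t) a b a a
        ≤ rSum A (fun u v => t * ψ u v) (P t) a b a a S'
          + ENNReal.ofReal (M * Real.exp (-(3 * C * t))) ∧
      pSum A (fun u v => t * ψ u v) (P t) a b a b
          * pSum A (fun u v => t * ψ u v) (P t) a b b a
        ≤ rSum A (fun u v => t * ψ u v) (P t) a b a b S'
            * rSum A (fun u v => t * ψ u v) (P t) a b b a S'
          + ENNReal.ofReal (M * Real.exp (-(3 * C * t))) := by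
  classical
  obtain ⟨s, hs, hsφ⟩ := hsum
  have hψ : ∀ u v, A u v → ψ u v ≤ 0 ∧ ψ u v ≤ s u ∧ (u ∉ I → ψ u v ≤ -d) ∧
      (u ∉ S' → ψ u v ≤ -(7 * C + 2 * d)) := by
    intro u v huv
    obtain ⟨x, rfl, rfl⟩ := hA.exists_point huv
    rw [← hMarkov x]
    refine ⟨hneg x, hsφ _ x rfl, fun h => hI _ h x rfl, fun h => ?_⟩
    by_contra! hlt
    exact h (hS' _ ⟨x, rfl, by linarith⟩)
  set K : ℝ := ∑' i, Real.exp (s i) with hK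
  have hK0 : 0 ≤ K := tsum_nonneg fun i => (Real.exp_nonneg _)
  refine ⟨1 + 2 * K / d, by positivity, 8 * (I.card : ℝ) ^ 2 * Real.exp (2 * (N * P 1) + 7 * C), ?_⟩
  intro a ha b hb hab t ht
  have hKd : 0 ≤ 2 * K / d := by positivity
  have ht1 : 1 ≤ t := by linarith
  have hPt : P t ≤ P 1 := by
    obtain ⟨⟨v, hv⟩, -⟩ := hA 0
    obtain ⟨x, hx, -⟩ := hA.exists_point hv
    have h1 := PGur_mono A (φ := fun x => t * φ x) (φ' := fun x => 1 * φ x)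
      (fun x => by nlinarith [hneg x]) 0
    rw [hP t ht1 0 ⟨x, hx⟩, hP 1 le_rfl 0 ⟨x, hx⟩] at h1
    exact_mod_cast h1
  set k := potKernel A (fun u v => t * ψ u v) (P t) with hkdef
  have hkle : ∀ u v r, (A u v → t * ψ u v ≤ r) → k u v ≤ ENNReal.ofReal (Real.exp r) := by
    intro u v r h
    rw [hkdef, potKernel]
    split_ifs with huv
    · refine ENNReal.ofReal_le_ofReal (Real.exp_le_exp.2 ?_)
      linarith [h huv, hP0 t ht1]
    · exact zero_le
  have hk1 : ∀ u v, k u v ≤ 1 := by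
    intro u v
    simpa using hkle u v 0 fun huv => mul_nonpos_of_nonneg_of_nonpos (by linarith) (hψ u v huv).1
  set q : ℕ → ℝ≥0∞ := fun u => ENNReal.ofReal (Real.exp (s u - (t - 1) * d)) with hq
  set ε : ℝ≥0∞ := ENNReal.ofReal (Real.exp (-(7 * C * (t - 1)))) with hε
  have hkI : ∀ u ∉ I, ∀ v, k u v ≤ q u := by
    intro u hu v
    refine hkle u v _ fun huv => ?_
    obtain ⟨-, h1, h2, -⟩ := hψ u v huv
    nlinarith [h2 hu]
  have hkS : ∀ u ∉ S', ∀ v, k u v ≤ ε * q u := by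
    intro u hu v
    rw [hε, hq, ← ENNReal.ofReal_mul (Real.exp_nonneg _), ← Real.exp_add]
    refine hkle u v _ fun huv => ?_
    obtain ⟨-, h1, -, h2⟩ := hψ u v huv
    nlinarith [mul_le_mul_of_nonneg_left (h2 hu) (sub_nonneg.2 ht1),
      mul_nonneg (sub_nonneg.2 ht1) hd.le]
  have hqsum : ∑' u, q u ≤ 2⁻¹ := by
    have h1 : ∀ u, q u = ENNReal.ofReal (Real.exp (-((t - 1) * d))) *
        ENNReal.ofReal (Real.exp (s u)) := by
      intro u
      rw [hq, ← ENNReal.ofReal_mul (Real.exp_nonneg _), ← Real.exp_add, neg_add_eq_sub]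
    rw [tsum_congr h1, ENNReal.tsum_mul_left,
      ← ENNReal.ofReal_tsum_of_nonneg (fun _ => Real.exp_nonneg _) hs, ← hK,
      ← ENNReal.ofReal_mul (Real.exp_nonneg _)]
    have h2 : (2⁻¹ : ℝ≥0∞) = ENNReal.ofReal 2⁻¹ := by
      rw [ENNReal.ofReal_inv_of_pos (by norm_num)]; norm_num
    rw [h2]
    refine ENNReal.ofReal_le_ofReal ?_
    have h3 : 2 * K < (t - 1) * d := by
      rw [← div_lt_iff₀ hd]; linarith
    have h4 := Real.add_one_le_exp ((t - 1) * d)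
    rw [Real.exp_neg, inv_mul_le_iff₀ (Real.exp_pos _)]
    linarith
  obtain ⟨h, hT, hh, hhT, hleft, hright, -, -⟩ := (hGM t ht1).eigen
  set e : ℝ := Real.exp (C * t + N * P 1) with he
  have hloop : ∀ x ∈ I, ∀ y ∈ I, ∃ l, (ENNReal.ofReal e)⁻¹ ≤ chainProd k (x :: l ++ [y]) := by
    intro x hx y hy
    rw [he, ← ENNReal.ofReal_inv_of_pos (Real.exp_pos _), ← Real.exp_neg]
    exact exists_chainProd_ge_of_loop A ψ t (P t) (P 1) C N (by linarith) (hP0 t ht1) hPt hk1 x y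
      (hloops x hx y hy)
  have he0 : ENNReal.ofReal e ≠ 0 := by simpa using Real.exp_pos _
  have hgT : ∀ u, ∑' v, k u v * ENNReal.ofReal (hT v) ≤ ENNReal.ofReal (hT u) := fun u =>
    tsum_potWeight_mul_le (A u) (fun v => t * ψ u v) hT (P t) (hT u) (hright u)
  have hgh : ∀ v, ∑' u, k u v * ENNReal.ofReal (h u) ≤ ENNReal.ofReal (h v) := fun v =>
    tsum_potWeight_mul_le (A · v) (fun u => t * ψ u v) h (P t) (h v) (hleft v)
  have hratio : ∀ (κ : ℕ → ℕ → ℝ≥0∞) (g : ℕ → ℝ), (∀ u, ∑' v, κ u v * ENNReal.ofReal (g v)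
      ≤ ENNReal.ofReal (g u)) → (∀ y ∈ I, ∃ l, (ENNReal.ofReal e)⁻¹ ≤ chainProd κ (a :: l ++ [y]))
      → ∀ i ∈ I, ENNReal.ofReal (g i) ≤ ENNReal.ofReal e * ENNReal.ofReal (g a) := by
    intro κ g hg hl i hi
    obtain ⟨l, hl⟩ := hl i hi
    rw [← ENNReal.inv_mul_le_iff he0 ENNReal.ofReal_ne_top]
    exact (mul_le_mul_left hl _).trans (chainProd_mul_le_of_superharmonic κ _ hg i l a)
  have hbad := tsum_leavesLoop_le k I S' hIS q ε (ENNReal.ofReal e) hk1 hkI hkS hqsum a ha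
    (fun v => ENNReal.ofReal (hT v)) (fun v => ENNReal.ofReal (h v)) hgT hgh
    (by simpa using hhT a) (by simpa using hh a) ENNReal.ofReal_ne_top ENNReal.ofReal_ne_top
    (hratio k hT hgT (hloop a ha))
    (hratio (fun u v => k v u) h hgh fun y hy => by
      obtain ⟨l, hl⟩ := hloop y hy a ha
      refine ⟨l.reverse, hl.trans (le_of_eq ?_)⟩
      simpa using chainProd_reverse k (a :: l.reverse ++ [y]))
  have hfinal : (I.card * (1 + ENNReal.ofReal e)) * (ε * 2 * (I.card * (1 + ENNReal.ofReal e)))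
      ≤ ENNReal.ofReal (8 * (I.card : ℝ) ^ 2 * Real.exp (2 * (N * P 1) + 7 * C)
        * Real.exp (-(3 * C * t))) := by
    have hnn : 0 ≤ Real.exp (-(7 * C * (t - 1))) := Real.exp_nonneg _
    have he1 : 1 ≤ e := Real.one_le_exp (by have := hP0 1 le_rfl; positivity)
    have h1 : (1 : ℝ≥0∞) + ENNReal.ofReal e = ENNReal.ofReal (1 + e) := by
      rw [ENNReal.ofReal_add zero_le_one (by linarith), ENNReal.ofReal_one]
    have h2 : (2 : ℝ≥0∞) = ENNReal.ofReal 2 := by simp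
    have h3 : (I.card : ℝ≥0∞) = ENNReal.ofReal I.card := by simp
    rw [h1, h2, h3, ← ENNReal.ofReal_mul (by positivity), hε, ← ENNReal.ofReal_mul hnn,
      ← ENNReal.ofReal_mul (by positivity), ← ENNReal.ofReal_mul (by positivity)]
    refine ENNReal.ofReal_le_ofReal ?_
    calc _ ≤ ((I.card : ℝ) * (e + e)) * (Real.exp (-(7 * C * (t - 1))) * 2 *
            ((I.card : ℝ) * (e + e))) := by gcongr
      _ = 8 * (I.card : ℝ) ^ 2 * (e * e * Real.exp (-(7 * C * (t - 1)))) := by ring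
      _ ≤ 8 * (I.card : ℝ) ^ 2 * (Real.exp (2 * (N * P 1) + 7 * C) * Real.exp (-(3 * C * t))) := by
          refine mul_le_mul_of_nonneg_left ?_ (by positivity)
          rw [he, ← Real.exp_add, ← Real.exp_add, ← Real.exp_add]
          refine Real.exp_le_exp.2 ?_
          nlinarith [mul_nonneg hC (by linarith : (0 : ℝ) ≤ t)]
      _ = _ := by ring
  exact ⟨(pSum_self_le A _ _ a b S' (hIS ha)).trans (by gcongr; exact hbad.trans hfinal),
    (pSum_mul_pSum_le A _ _ a b hab S' (hIS ha) (hIS hb)).trans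
      (by gcongr; exact hbad.trans hfinal)⟩
end
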